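/- arXiv:0712.2946 — 2 statements merged into one kernel-verified Lean document; each statement's English description precedes it below -/
import Mathlib

section
/- Let 𝒦 = (K,𝒜) be a system of isometries with associated ℝ-tree T_𝒦, and let X ∈ ∂F(𝒜) be not eventually admissible. Then: the terminal points Qᵢ of the nested segments [K, XᵢK] (taken over the indices i for which the prefix Xᵢ is non-admissible, so that K and XᵢK are disjoint) converge in T̂_𝒦 with respect to the observers' topology to a point 𝒬_𝒦(X); for every sequence wₙ ∈ F(𝒜) converging in F(𝒜) ∪ ∂F(𝒜) to X and every choice of points Pₙ ∈ wₙK, the sequence Pₙ converges to 𝒬_𝒦(X) in the observers' topology on T̂_𝒦; and 𝒬_𝒦(X) belongs to T̂_𝒦 ∖ T_𝒦. -/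
/-!
Common formalization framework for "ℝ-trees, dual laminations, and compact systems
of partial isometries" (Coulbois–Hilion–Lustig).
-/

open Set Filter Topology Pointwise

noncomputable section

namespace CHL

/-! ### ℝ-trees -/

/-- The metric betweenness segment `[x,y]`.  In an ℝ-tree this is exactly the unique
topological arc joining `x` to `y`, which is a geodesic segment. -/
def seg {T : Type*} [MetricSpace T] (x y : T) : Set T :=
  {z | dist x z + dist z y = dist x y}

/-- An ℝ-tree: a geodesic metric space which is `0`-hyperbolic (four point condition).
Equivalently, any two points are joined by a unique topological arc, and this arc is a
geodesic segment. -/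
class IsRTree (T : Type*) [MetricSpace T] : Prop where
  geodesic : ∀ x y : T, ∃ f : ℝ → T, f 0 = x ∧ f (dist x y) = y ∧
      ∀ s ∈ Set.Icc (0 : ℝ) (dist x y), ∀ t ∈ Set.Icc (0 : ℝ) (dist x y),
        dist (f s) (f t) = |s - t|
  four_point : ∀ x y z w : T,
      dist x y + dist z w ≤ max (dist x z + dist y w) (dist x w + dist y z)

/-- A subtree of an ℝ-tree: a convex subset. -/
def IsSubtree {T : Type*} [MetricSpace T] (A : Set T) : Prop :=
  ∀ x ∈ A, ∀ y ∈ A, seg x y ⊆ A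

/-- A non-empty closed subtree. -/
def IsClosedSubtree {T : Type*} [MetricSpace T] (A : Set T) : Prop :=
  A.Nonempty ∧ IsClosed A ∧ IsSubtree A

/-- The convex hull of a subset of an ℝ-tree: the smallest subtree containing it. -/
def subtreeHull {T : Type*} [MetricSpace T] (S : Set T) : Set T :=
  ⋂₀ {A : Set T | S ⊆ A ∧ IsSubtree A}

/-- A finite tree: the convex hull of finitely many points. -/
def IsFiniteSubtree {T : Type*} [MetricSpace T] (A : Set T) : Prop :=
  ∃ F : Finset T, A = subtreeHull (F : Set T)

/-- `[x,x']` is the segment joining `A` to `B`: its endpoints are the only points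
in `A` resp. `B` that it meets. -/
def IsBridge {T : Type*} [MetricSpace T] (A B : Set T) (x x' : T) : Prop :=
  x ∈ A ∧ x' ∈ B ∧ seg x x' ∩ A = {x} ∧ seg x x' ∩ B = {x'}

/-- A morphism of ℝ-trees: a continuous map such that every segment is mapped locally
injectively except at finitely many points. -/
def IsTreeMorphism {T T' : Type*} [MetricSpace T] [MetricSpace T'] (f : T → T') : Prop :=
  Continuous f ∧ ∀ x y : T, ∃ F : Finset T, ∀ p ∈ seg x y, p ∉ (F : Set T) →
    ∃ U ∈ nhdsWithin p (seg x y), Set.InjOn f U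

/-- The translation length `‖g‖_T = inf_{x ∈ T} d(x, gx)`. -/
def translationLength (G : Type*) [Group G] (T : Type*) [MetricSpace T] [MulAction G T]
    (g : G) : ℝ :=
  ⨅ x : T, dist x (g • x)

/-- The translation length of `g` on an invariant subtree `A`. -/
def translationLengthOn {G : Type*} [Group G] {T : Type*} [MetricSpace T] [MulAction G T]
    (A : Set T) (g : G) : ℝ :=
  ⨅ x : A, dist (x : T) (g • (x : T))

/-- The minimal `G`-invariant subtree. -/
def minSubtree (G : Type*) [Group G] (T : Type*) [MetricSpace T] [MulAction G T] : Set T :=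
  ⋂₀ {A : Set T | A.Nonempty ∧ IsSubtree A ∧ ∀ g : G, ∀ x ∈ A, g • x ∈ A}

/-! ### Free groups, reduced words and the boundary `∂F(𝒜)` -/

/-- Two letters of `𝒜^{±1}` are inverse to each other. -/
def LettersInv {ι : Type*} (a b : ι × Bool) : Prop := a.1 = b.1 ∧ a.2 = !b.2

/-- The prefix of length `n` of (the reduced word of) `w`. -/
def gprefix {ι : Type*} [DecidableEq ι] (w : FreeGroup ι) (n : ℕ) : FreeGroup ι :=
  FreeGroup.mk (w.toWord.take n)

/-- An infinite reduced word in the letters `𝒜^{±1}`: a point of the Gromov boundary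
`∂F(𝒜)` of the free group `F(𝒜)`. -/
structure InfWord (ι : Type*) where
  letter : ℕ → ι × Bool
  reduced : ∀ n, ¬ LettersInv (letter n) (letter (n + 1))

/-- The prefix `X_n` of length `n` of an infinite reduced word `X`. -/
def InfWord.prefixN {ι : Type*} (X : InfWord ι) (n : ℕ) : FreeGroup ι :=
  FreeGroup.mk (List.ofFn fun i : Fin n => X.letter i)

/-- The infinite word `X_k⁻¹ X` obtained by deleting the first `k` letters. -/
def InfWord.shift {ι : Type*} (X : InfWord ι) (k : ℕ) : InfWord ι :=
  ⟨fun n => X.letter (k + n), fun n => X.reduced (k + n)⟩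

/-- A sequence `wₙ ∈ F(𝒜)` converges in `F(𝒜) ∪ ∂F(𝒜)` to the infinite word `X` iff
the length of the maximal common prefix of `wₙ` and `X` tends to infinity. -/
def TendstoBoundary {ι : Type*} [DecidableEq ι] (w : ℕ → FreeGroup ι) (X : InfWord ι) : Prop :=
  ∀ k : ℕ, ∀ᶠ n in atTop, (w n).toWord.take k = List.ofFn fun i : Fin k => X.letter i

/-- `Y = w · X` for the left action of `F(𝒜)` on its boundary `∂F(𝒜)`. -/
def SmulBoundary {ι : Type*} [DecidableEq ι] (w : FreeGroup ι) (X Y : InfWord ι) : Prop :=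
  TendstoBoundary (fun n => w * X.prefixN n) Y

/-- The (Cantor set) topology on `∂F(𝒜)`, induced by the product topology on sequences
of letters. -/
instance {ι : Type*} : TopologicalSpace (InfWord ι) :=
  TopologicalSpace.induced (fun X => X.letter)
    (@Pi.topologicalSpace ℕ (fun _ => ι × Bool) fun _ => ⊥)

/-- A non-trivial element of `F(𝒜)` is cyclically reduced if the first letter of its reduced
word is not the inverse of its last letter. -/
def IsCyclicallyReduced {ι : Type*} [DecidableEq ι] (w : FreeGroup ι) : Prop :=
  w ≠ 1 ∧ ∀ a ∈ w.toWord.head?, ∀ b ∈ w.toWord.getLast?, ¬ LettersInv a b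

/-- The dual laminary language `ℒ_𝒜(T)` of an isometric action of `F(𝒜)` on `T`. -/
def dualLanguage (ι : Type*) [DecidableEq ι] (T : Type*) [MetricSpace T]
    [MulAction (FreeGroup ι) T] : Set (FreeGroup ι) :=
  {v | ∀ ε > (0 : ℝ), ∃ u w : FreeGroup ι,
      (u * v * w).toWord = u.toWord ++ v.toWord ++ w.toWord ∧
      IsCyclicallyReduced (u * v * w) ∧
      translationLength (FreeGroup ι) T (u * v * w) < ε}

/-- The dual laminary language `ℒ_𝒜(T)`, for the action restricted to an invariant
subtree `A`. -/
def dualLanguageOn (ι : Type*) [DecidableEq ι] {T : Type*} [MetricSpace T]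
    [MulAction (FreeGroup ι) T] (A : Set T) : Set (FreeGroup ι) :=
  {v | ∀ ε > (0 : ℝ), ∃ u w : FreeGroup ι,
      (u * v * w).toWord = u.toWord ++ v.toWord ++ w.toWord ∧
      IsCyclicallyReduced (u * v * w) ∧
      translationLengthOn A (u * v * w) < ε}

/-! ### Systems of isometries on a compact ℝ-tree -/

/-- A system of isometries `𝒦 = (K, 𝒜)`: a family, indexed by `ι`, of non-empty partial
isometries of the compact ℝ-tree `K`, i.e. isometries between non-empty closed subtrees. -/
structure SystemOfIsometries (K : Type*) [MetricSpace K] (ι : Type*) where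
  pe : ι → PartialEquiv K K
  isom : ∀ i, ∀ x ∈ (pe i).source, ∀ y ∈ (pe i).source, dist (pe i x) (pe i y) = dist x y
  source_subtree : ∀ i, IsClosedSubtree (pe i).source
  target_subtree : ∀ i, IsClosedSubtree (pe i).target

namespace SystemOfIsometries

variable {K : Type*} [MetricSpace K] {ι : Type*} (S : SystemOfIsometries K ι)

/-- The partial isometry associated to a letter in `𝒜^{±1}`. -/
def letterPE : ι × Bool → PartialEquiv K K
  | (i, true) => S.pe i
  | (i, false) => (S.pe i).symm

/-- The partial isometry `z₁ ∘ z₂ ∘ ⋯ ∘ zₙ` (acting on the right: first `z₁`, then `z₂`, …)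
associated to the reduced word `w = z₁ ⋯ zₙ ∈ F(𝒜)`. -/
def wordPE [DecidableEq ι] (w : FreeGroup ι) : PartialEquiv K K :=
  (w.toWord.map S.letterPE).foldl PartialEquiv.trans (PartialEquiv.refl K)

/-- The domain `dom (w)` of the partial isometry associated to `w`. -/
def dom [DecidableEq ι] (w : FreeGroup ι) : Set K := (S.wordPE w).source

/-- A word is admissible if it is non-empty as a partial isometry of `K`. -/
def Admissible [DecidableEq ι] (w : FreeGroup ι) : Prop := (S.dom w).Nonempty

/-- An infinite word is admissible if all its prefixes are admissible. -/
def AdmissibleInf [DecidableEq ι] (X : InfWord ι) : Prop := ∀ n, S.Admissible (X.prefixN n)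

/-- The domain of an infinite word: the intersection of the domains of its prefixes. -/
def domInf [DecidableEq ι] (X : InfWord ι) : Set K := ⋂ n, S.dom (X.prefixN n)

/-- An infinite word `X` is eventually admissible if some suffix `X_k⁻¹ X` is admissible. -/
def EventuallyAdmissible [DecidableEq ι] (X : InfWord ι) : Prop :=
  ∃ k, S.AdmissibleInf (X.shift k)

/-- The system `𝒦` has independent generators if the (non-empty) domain of every
admissible infinite word consists of exactly one point. -/
def IndependentGenerators [DecidableEq ι] : Prop :=
  ∀ X : InfWord ι, S.AdmissibleInf X → ∃ x : K, S.domInf X = {x}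

/-- The admissible laminary language `ℒ_adm(𝒦)`: the largest laminary language consisting of
admissible words; `w ∈ ℒ_adm(𝒦)` iff for every `k` the word `w` is obtained from some
admissible word `v` by deleting its prefix and its suffix of length `k`. -/
def admLanguage [DecidableEq ι] : Set (FreeGroup ι) :=
  {w | ∀ k : ℕ, ∃ v : FreeGroup ι, S.Admissible v ∧
      ∃ p s : List (ι × Bool), p.length = k ∧ s.length = k ∧
        v.toWord = p ++ w.toWord ++ s}

end SystemOfIsometries

/-- The ℝ-tree `T_𝒦` associated to a system of isometries `𝒦 = (K, 𝒜)`, presented through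
its characteristic properties (Theorem 3.2 of the paper, by which it is unique):
`T_𝒦` contains `K` as an isometrically embedded subtree (1); the left action of `F(𝒜)`
is compatible with the partial isometries (2); every orbit meets `K`, and indeed every
segment is covered by finitely many translates of `K` (3); and `T_𝒦` is universal among
trees satisfying (1) and (2), via unique equivariant morphisms (4). -/
structure AssocTree {K : Type} [MetricSpace K] {ι : Type} [DecidableEq ι]
    (S : SystemOfIsometries K ι) where
  carrier : Type
  [ms : MetricSpace carrier]
  tree : IsRTree carrier
  [act : MulAction (FreeGroup ι) carrier]
  act_isom : ∀ g : FreeGroup ι, Isometry fun x : carrier => g • x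
  emb : K → carrier
  emb_isom : Isometry emb
  emb_subtree : IsSubtree (Set.range emb)
  compat : ∀ i : ι, ∀ x ∈ (S.pe i).source, (FreeGroup.of i)⁻¹ • emb x = emb (S.pe i x)
  orbit_meets : ∀ p : carrier, ∃ (w : FreeGroup ι) (x : K), p = w • emb x
  seg_cover : ∀ p q : carrier, ∃ F : Finset (FreeGroup ι),
      seg p q ⊆ ⋃ w ∈ F, w • Set.range emb
  universal : ∀ (T' : Type) [MetricSpace T'] [MulAction (FreeGroup ι) T'],
      (∀ g : FreeGroup ι, Isometry fun x : T' => g • x) →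
      ∀ e' : K → T', Isometry e' →
      (∀ i : ι, ∀ x ∈ (S.pe i).source, (FreeGroup.of i)⁻¹ • e' x = e' (S.pe i x)) →
      ∃! f : carrier → T', IsTreeMorphism f ∧
        (∀ (g : FreeGroup ι) (p : carrier), f (g • p) = g • f p) ∧
        ∀ x : K, f (emb x) = e' x

attribute [instance] AssocTree.ms AssocTree.act

/-! ### Very small minimal actions with dense orbits, and their metric completion -/

/-- An ℝ-tree `T` (here: the subtree `Tsub` of the complete ℝ-tree `Tb`, whose metric
completion `T̄` is `Tb`) with a very small, minimal, isometric action of the free group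
`F(𝒜)` with dense orbits.  (For actions with dense orbits, "very small" is equivalent to
"trivial arc stabilizers".) -/
structure TreeSetup (ι : Type) where
  Tb : Type
  [ms : MetricSpace Tb]
  complete : CompleteSpace Tb
  tree : IsRTree Tb
  [act : MulAction (FreeGroup ι) Tb]
  act_isom : ∀ g : FreeGroup ι, Isometry fun x : Tb => g • x
  Tsub : Set Tb
  nonempty : Tsub.Nonempty
  dense : Dense Tsub
  sub_subtree : IsSubtree Tsub
  invariant : ∀ g : FreeGroup ι, ∀ x ∈ Tsub, g • x ∈ Tsub
  minimal : ∀ A : Set Tb, A ⊆ Tsub → A.Nonempty → IsSubtree A →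
      (∀ g : FreeGroup ι, ∀ x ∈ A, g • x ∈ A) → A = Tsub
  dense_orbits : ∀ x ∈ Tsub, Tsub ⊆ closure (Set.range fun g : FreeGroup ι => g • x)
  arc_stab : ∀ g : FreeGroup ι, ∀ x ∈ Tsub, ∀ y ∈ Tsub, x ≠ y →
      (fun p => g • p) '' seg x y = seg x y → g = 1

attribute [instance] TreeSetup.ms TreeSetup.act

/-- `𝒬(X) = Q` (for `Q ∈ T̄`), where `𝒬 : ∂F_N → T̂` is the map of Levitt–Lustig:
it is characterized by the property that whenever a sequence `uₙ ∈ F_N` converges to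
`X ∈ ∂F_N` and `uₙ P` converges metrically in `T̄` to a point `Q`, then `𝒬(X) = Q`. -/
def QRel {ι : Type} [DecidableEq ι] (St : TreeSetup ι) (X : InfWord ι) (Q : St.Tb) : Prop :=
  ∃ P ∈ St.Tsub, ∃ u : ℕ → FreeGroup ι, TendstoBoundary u X ∧
    Tendsto (fun n => u n • P) atTop (𝓝 Q)

/-- The limit set `Ω_𝒜 = 𝒬²(C²_𝒜 ∩ L²(T)) ⊆ T̄`: images of pairs of distinct boundary
points with distinct first letters (w.r.t. the basis `𝒜`) that are identified by `𝒬`. -/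
def limitSet {ι : Type} [DecidableEq ι] (St : TreeSetup ι) : Set St.Tb :=
  {Q | ∃ X Y : InfWord ι, X.letter 0 ≠ Y.letter 0 ∧ QRel St X Q ∧ QRel St Y Q}

/-- The heart `K_𝒜 ⊆ T̄`: the convex hull of the limit set `Ω_𝒜`. -/
def heart {ι : Type} [DecidableEq ι] (St : TreeSetup ι) : Set St.Tb :=
  subtreeHull (limitSet St)

/-- The dual algebraic lamination `L²(T) = {(X,Y) ∈ ∂²F_N : 𝒬(X) = 𝒬(Y)}`. -/
def L2 {ι : Type} [DecidableEq ι] (St : TreeSetup ι) : Set (InfWord ι × InfWord ι) :=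
  {p | p.1 ≠ p.2 ∧ ∃ Q : St.Tb, QRel St p.1 Q ∧ QRel St p.2 Q}

/-! ### The system of isometries induced on a compact subtree `K ⊆ T̄` -/

/-- The domain, inside `T̄`, of the partial isometry `x ↦ w⁻¹ x` of `K` induced by the word
`w`: the intersection of the translates of `K` by the prefixes of `w`. -/
def inducedDom {ι : Type} [DecidableEq ι] (St : TreeSetup ι) (K : Set St.Tb)
    (w : FreeGroup ι) : Set St.Tb :=
  ⋂ n ∈ Finset.range (w.toWord.length + 1), gprefix w n • K

/-- Admissibility of a word for the induced system of isometries `𝒦 = (K, 𝒜)`. -/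
def InducedAdmissible {ι : Type} [DecidableEq ι] (St : TreeSetup ι) (K : Set St.Tb)
    (w : FreeGroup ι) : Prop :=
  (inducedDom St K w).Nonempty

/-- The admissible laminary language `ℒ_adm(𝒦)` of the induced system `𝒦 = (K, 𝒜)`. -/
def inducedAdmLanguage {ι : Type} [DecidableEq ι] (St : TreeSetup ι) (K : Set St.Tb) :
    Set (FreeGroup ι) :=
  {w | ∀ k : ℕ, ∃ v : FreeGroup ι, InducedAdmissible St K v ∧
      ∃ p s : List (ι × Bool), p.length = k ∧ s.length = k ∧
        v.toWord = p ++ w.toWord ++ s}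

/-- Admissibility of an infinite word for the induced system `𝒦 = (K, 𝒜)`. -/
def InducedAdmissibleInf {ι : Type} [DecidableEq ι] (St : TreeSetup ι) (K : Set St.Tb)
    (X : InfWord ι) : Prop :=
  ∀ n, InducedAdmissible St K (X.prefixN n)

/-- The domain `dom(X) = ⋂ₙ dom(Xₙ)` of an infinite word, for the induced system. -/
def inducedDomInf {ι : Type} [DecidableEq ι] (St : TreeSetup ι) (K : Set St.Tb)
    (X : InfWord ι) : Set St.Tb :=
  ⋂ n, X.prefixN n • K

/-- Compatibility of a map `e : K → T'` with the system of partial isometries induced on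
`K ⊆ T̄` by the basis `𝒜`: this is condition (2) of Theorem 3.2 for the induced system. -/
def InducedCompat {ι : Type} (St : TreeSetup ι) (K : Set St.Tb) {T' : Type} [MetricSpace T']
    [MulAction (FreeGroup ι) T'] (e : K → T') : Prop :=
  ∀ (i : ι) (x : K) (h : (FreeGroup.of i)⁻¹ • (x : St.Tb) ∈ K),
    (FreeGroup.of i)⁻¹ • e x = e ⟨(FreeGroup.of i)⁻¹ • (x : St.Tb), h⟩

/-- The tree `T_𝒦` associated to the system of isometries induced on a compact subtree
`K ⊆ T̄`, presented through the characteristic properties of Theorem 3.2 (by which it is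
unique), together with the canonical `F(𝒜)`-equivariant morphism `j : T_𝒦 → T̄` restricting
to the identity on `K`. -/
structure InducedAssoc {ι : Type} (St : TreeSetup ι) (K : Set St.Tb) where
  TK : Type
  [ms : MetricSpace TK]
  tree : IsRTree TK
  [act : MulAction (FreeGroup ι) TK]
  act_isom : ∀ g : FreeGroup ι, Isometry fun x : TK => g • x
  emb : K → TK
  emb_isom : Isometry emb
  emb_subtree : IsSubtree (Set.range emb)
  compat : InducedCompat St K emb
  orbit_meets : ∀ p : TK, ∃ (w : FreeGroup ι) (x : K), p = w • emb x
  seg_cover : ∀ p q : TK, ∃ F : Finset (FreeGroup ι),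
      seg p q ⊆ ⋃ w ∈ F, w • Set.range emb
  universal : ∀ (T' : Type) [MetricSpace T'] [MulAction (FreeGroup ι) T'],
      (∀ g : FreeGroup ι, Isometry fun x : T' => g • x) →
      ∀ e' : K → T', Isometry e' → InducedCompat St K e' →
      ∃! f : TK → T', IsTreeMorphism f ∧
        (∀ (g : FreeGroup ι) (p : TK), f (g • p) = g • f p) ∧
        ∀ x : K, f (emb x) = e' x
  jmap : TK → St.Tb
  jmap_morphism : IsTreeMorphism jmap
  jmap_equivariant : ∀ (g : FreeGroup ι) (p : TK), jmap (g • p) = g • jmap p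
  jmap_emb : ∀ x : K, jmap (emb x) = (x : St.Tb)

attribute [instance] InducedAssoc.ms InducedAssoc.act

/-! ### Change of basis -/

/-- Changing the basis of the free group: the same tree, with the action precomposed with
the automorphism `φ` of `F(𝒜)`.  The heart of `St.twist φ` is the heart of `T` with respect
to the basis `φ(𝒜)`. -/
def TreeSetup.twist {ι : Type} (St : TreeSetup ι) (φ : FreeGroup ι ≃* FreeGroup ι) :
    TreeSetup ι where
  Tb := St.Tb
  ms := St.ms
  complete := St.complete
  tree := St.tree
  act := { smul := fun g x => φ g • x
           one_smul := fun x => by show φ 1 • x = x; rw [map_one, one_smul]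
           mul_smul := fun g h x => by
             show φ (g * h) • x = φ g • φ h • x
             rw [map_mul, mul_smul] }
  act_isom := fun g => St.act_isom (φ g)
  Tsub := St.Tsub
  nonempty := St.nonempty
  dense := St.dense
  sub_subtree := St.sub_subtree
  invariant := fun g x hx => St.invariant (φ g) x hx
  minimal := fun A hA hne hsub hinv => St.minimal A hA hne hsub (fun g x hx => by
    have h : φ (φ.symm g) • x ∈ A := hinv (φ.symm g) x hx
    rwa [MulEquiv.apply_symm_apply] at h)
  dense_orbits := fun x hx => by
    have hr : (Set.range fun g : FreeGroup ι => φ g • x) =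
        Set.range fun g : FreeGroup ι => g • x := by
      apply Set.ext; intro y
      constructor
      · rintro ⟨g, rfl⟩; exact ⟨φ g, rfl⟩
      · rintro ⟨g, rfl⟩; exact ⟨φ.symm g, by simp⟩
    show St.Tsub ⊆ closure (Set.range fun g : FreeGroup ι => φ g • x)
    rw [hr]; exact St.dense_orbits x hx
  arc_stab := fun g x hx y hy hxy him => by
    have h1 : φ g = 1 := St.arc_stab (φ g) x hx y hy hxy him
    have h2 := congrArg φ.symm h1
    simpa using h2

/-! ### The boundary `∂T`, the space `T̂ = T̄ ∪ ∂T` and the observers' topology -/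

/-- An isometric ray (parametrized on `[0,∞)`) in a metric space. -/
def IsRay {T : Type} [MetricSpace T] (r : ℝ → T) : Prop :=
  ∀ s t : ℝ, 0 ≤ s → 0 ≤ t → dist (r s) (r t) = |s - t|

/-- The type of isometric rays in `T`. -/
def Ray (T : Type) [MetricSpace T] : Type := {r : ℝ → T // IsRay r}

/-- Two rays define the same end iff they are at bounded distance. -/
def rayEnd (T : Type) [MetricSpace T] : Setoid (Ray T) where
  r := fun r₁ r₂ => ∃ C : ℝ, ∀ t : ℝ, 0 ≤ t → dist (r₁.1 t) (r₂.1 t) ≤ C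
  iseqv := by
    refine ⟨fun r => ⟨0, fun t _ => by simp⟩, ?_, ?_⟩
    · rintro r₁ r₂ ⟨C, hC⟩
      exact ⟨C, fun t ht => by rw [dist_comm]; exact hC t ht⟩
    · rintro r₁ r₂ r₃ ⟨C, hC⟩ ⟨D, hD⟩
      exact ⟨C + D, fun t ht =>
        (dist_triangle _ (r₂.1 t) _).trans (add_le_add (hC t ht) (hD t ht))⟩

/-- The Gromov boundary `∂T`: ends of `T`, i.e. classes of rays at bounded distance. -/
def GromovBoundary (T : Type) [MetricSpace T] : Type := Quotient (rayEnd T)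

/-- The space `T̂ = T̄ ∪ ∂T` (for `T` a complete ℝ-tree, representing the completion `T̄`). -/
def TreeHat (T : Type) [MetricSpace T] : Type := T ⊕ GromovBoundary T

/-- The segment `[x, ξ]` from a point `x ∈ T̄` to a boundary point `ξ ∈ ∂T`. -/
def raySeg {T : Type} [MetricSpace T] (x : T) (ξ : GromovBoundary T) : Set (TreeHat T) :=
  ({Sum.inr ξ} : Set (TreeHat T)) ∪ Sum.inl ''
    {p | ∃ r : Ray T, Quotient.mk (rayEnd T) r = ξ ∧ r.1 0 = x ∧ ∃ t : ℝ, 0 ≤ t ∧ r.1 t = p}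

/-- The segment `[ξ, η]` between two boundary points. -/
def lineSeg {T : Type} [MetricSpace T] (ξ η : GromovBoundary T) : Set (TreeHat T) :=
  ({Sum.inr ξ, Sum.inr η} : Set (TreeHat T)) ∪ Sum.inl ''
    {p | ∃ r r' : Ray T, Quotient.mk (rayEnd T) r = ξ ∧ Quotient.mk (rayEnd T) r' = η ∧
      r.1 0 = p ∧ r'.1 0 = p ∧ ∀ s t : ℝ, 0 ≤ s → 0 ≤ t → dist (r.1 s) (r'.1 t) = s + t}

/-- The segment `[P, Q]` between two points of `T̂ = T̄ ∪ ∂T`. -/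
def segHat {T : Type} [MetricSpace T] : TreeHat T → TreeHat T → Set (TreeHat T)
  | Sum.inl x, Sum.inl y => Sum.inl '' seg x y
  | Sum.inl x, Sum.inr ξ => raySeg x ξ
  | Sum.inr ξ, Sum.inl x => raySeg x ξ
  | Sum.inr ξ, Sum.inr η => lineSeg ξ η

/-- The observers' topology on `T̂`: generated by the set of directions, where the direction
at `P` containing `x` is the set of points `y` with `P ∉ [x,y]` (i.e. the connected component
of `T̂ ∖ {P}` containing `x`). -/
def observersTopology (T : Type) [MetricSpace T] : TopologicalSpace (TreeHat T) :=
  TopologicalSpace.generateFrom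
    {D | ∃ P x : TreeHat T, x ≠ P ∧ D = {y | y ≠ P ∧ P ∉ segHat x y}}

/-- The extension to `T̂ = T̄ ∪ ∂T` of an isometric action on `T̄`. -/
def TreeHat.smul {T : Type} [MetricSpace T] {G : Type} [Group G] [MulAction G T]
    (hiso : ∀ g : G, Isometry fun x : T => g • x) (g : G) : TreeHat T → TreeHat T
  | Sum.inl x => Sum.inl (g • x)
  | Sum.inr ξ => Sum.inr <| Quotient.map'
      (fun r : Ray T => (⟨fun t => g • r.1 t, fun s t hs ht => by
        have h := (hiso g).dist_eq (r.1 s) (r.1 t)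
        simpa using h.trans (r.2 s t hs ht)⟩ : Ray T))
      (fun r r' h => by
        obtain ⟨C, hC⟩ := h
        exact ⟨C, fun t ht => by
          have h' := (hiso g).dist_eq (r.1 t) (r'.1 t)
          simpa using h'.le.trans (hC t ht)⟩) ξ

/-! ### Laminations -/

/-- An algebraic lamination (as a set of pairs of boundary points) is closed by diagonal
leaves. -/
def ClosedByDiagonal {ι : Type} (L : Set (InfWord ι × InfWord ι)) : Prop :=
  ∀ X X' X'' : InfWord ι, (X, X') ∈ L → (X', X'') ∈ L → X = X'' ∨ (X, X'') ∈ L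

/-- Invariance of a lamination under the `F(𝒜)`-action on `∂²F(𝒜)`. -/
def InvariantLam {ι : Type} [DecidableEq ι] (L : Set (InfWord ι × InfWord ι)) : Prop :=
  ∀ (w : FreeGroup ι) (X X' Y Y' : InfWord ι), (X, X') ∈ L →
    SmulBoundary w X Y → SmulBoundary w X' Y' → (Y, Y') ∈ L

/-- Invariance of a lamination under the flip map. -/
def FlipInvariant {ι : Type} (L : Set (InfWord ι × InfWord ι)) : Prop :=
  ∀ X Y : InfWord ι, (X, Y) ∈ L → (Y, X) ∈ L

/-- The dual lamination `L²(T)` is minimal up to diagonal leaves: it contains no proper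
non-trivial sublamination that is closed by diagonal leaves. -/
def MinimalUpToDiagonal {ι : Type} [DecidableEq ι] (St : TreeSetup ι) : Prop :=
  ∀ L : Set (InfWord ι × InfWord ι), L ⊆ L2 St → L.Nonempty → IsClosed L →
    InvariantLam L → FlipInvariant L → ClosedByDiagonal L → L = L2 St

end CHL

namespace CHL

/-! ### Gromov products and segments in ℝ-trees -/

section Tree

variable {T : Type*} [MetricSpace T]

/-- The Gromov product `(a|b)_x`. -/
def gp (x a b : T) : ℝ := (dist x a + dist x b - dist a b) / 2

theorem gp_comm (x a b : T) : gp x a b = gp x b a := by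
  rw [gp, gp, dist_comm a b]; ring

theorem gp_nonneg (x a b : T) : 0 ≤ gp x a b := by
  have := dist_triangle a x b
  rw [dist_comm a x] at this
  rw [gp]; linarith

theorem gp_le_left (x a b : T) : gp x a b ≤ dist x a := by
  have := dist_triangle x a b
  rw [gp]; linarith

theorem mem_seg_iff_gp {z a b : T} : z ∈ seg a b ↔ gp z a b = 0 := by
  rw [gp, seg, mem_ofPred_eq, dist_comm a z]
  constructor <;> intro h <;> linarith

theorem not_mem_seg_iff_gp {z a b : T} : z ∉ seg a b ↔ 0 < gp z a b := by
  rw [mem_seg_iff_gp, (gp_nonneg z a b).lt_iff_ne', Ne]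

theorem left_mem_seg (a b : T) : a ∈ seg a b := by simp [seg]

theorem right_mem_seg (a b : T) : b ∈ seg a b := by simp [seg]

theorem seg_comm (a b : T) : seg a b = seg b a := by
  ext z; rw [mem_seg_iff_gp, mem_seg_iff_gp, gp_comm]

theorem mem_seg_trans {x u v w : T} (h₁ : u ∈ seg x v) (h₂ : v ∈ seg x w) : u ∈ seg x w := by
  simp only [seg, mem_ofPred_eq] at *
  have := dist_triangle u v w
  have := dist_triangle x u w
  linarith

theorem gp_eq_of_mem_seg {x u a : T} (h : u ∈ seg x a) : gp x u a = dist x u := by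
  simp only [seg, mem_ofPred_eq] at h
  rw [gp]; linarith

theorem exists_isBridge {A B : Set T} (hA : IsCompact A) (hB : IsCompact B) (hA' : A.Nonempty)
    (hB' : B.Nonempty) : ∃ x x', IsBridge A B x x' := by
  obtain ⟨⟨x, x'⟩, ⟨hx, hx'⟩, hmin⟩ := (hA.prod hB).exists_isMinOn (hA'.prod hB')
    (f := fun p : T × T => dist p.1 p.2) (by fun_prop)
  refine ⟨x, x', hx, hx', ?_, ?_⟩
  · refine Subset.antisymm ?_ (singleton_subset_iff.2 ⟨left_mem_seg x x', hx⟩)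
    rintro z ⟨hz, hzA⟩
    have := hmin (a := (z, x')) ⟨hzA, hx'⟩
    simp only [seg, mem_ofPred_eq] at hz this
    exact (dist_le_zero.1 (by linarith : dist x z ≤ 0)).symm
  · refine Subset.antisymm ?_ (singleton_subset_iff.2 ⟨right_mem_seg x x', hx'⟩)
    rintro z ⟨hz, hzB⟩
    have := hmin (a := (x, z)) ⟨hx, hzB⟩
    simp only [seg, mem_ofPred_eq] at hz this
    exact dist_le_zero.1 (by linarith : dist z x' ≤ 0)

theorem dist_eq_of_monotone_seg {x : T} {q : ℕ → T} (hq : ∀ i j, i ≤ j → q i ∈ seg x (q j))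
    {i j : ℕ} (h : i ≤ j) : dist (q i) (q j) = dist x (q j) - dist x (q i) := by
  have := hq i j h
  simp only [seg, mem_ofPred_eq] at this
  linarith

theorem mem_seg_of_tendsto {x l : T} {q : ℕ → T} (hq : ∀ i j, i ≤ j → q i ∈ seg x (q j))
    (hl : Tendsto q atTop (𝓝 l)) (i : ℕ) : q i ∈ seg x l := by
  have h₁ : Tendsto (fun j => dist x (q i) + dist (q i) (q j)) atTop
    (𝓝 (dist x (q i) + dist (q i) l)) := (tendsto_const_nhds.dist hl).const_add _
  have h₂ : Tendsto (fun j => dist x (q j)) atTop (𝓝 (dist x l)) := tendsto_const_nhds.dist hl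
  refine tendsto_nhds_unique_of_eventuallyEq h₁ h₂ ?_
  filter_upwards [eventually_ge_atTop i] with j hj
  exact hq i j hj

variable [IsRTree T]

theorem gp_min_le (x a b c : T) : min (gp x a b) (gp x b c) ≤ gp x a c := by
  have h := IsRTree.four_point a c b x
  rw [dist_comm a x, dist_comm b x, dist_comm c x, dist_comm c b] at h
  simp only [gp]
  rcases le_max_iff.1 h with h | h
  · exact (min_le_left _ _).trans (by linarith)
  · exact (min_le_right _ _).trans (by linarith)

theorem gp_pos_trans {x a b c : T} (h₁ : 0 < gp x a b) (h₂ : 0 < gp x b c) : 0 < gp x a c :=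
  (lt_min h₁ h₂).trans_le (gp_min_le x a b c)

theorem eq_of_mem_seg_of_dist_eq {x a b u v : T} (hu : u ∈ seg x a) (hv : v ∈ seg x b)
    (h : dist x u = dist x v) (hab : dist x u ≤ gp x a b) : u = v := by
  have h₁ := gp_min_le x u a b
  have h₂ := gp_min_le x u b v
  rw [gp_eq_of_mem_seg hu, min_eq_left hab] at h₁
  rw [gp_comm x b v, gp_eq_of_mem_seg hv, ← h, min_eq_right h₁] at h₂
  have h₃ : dist u v ≤ 0 := by
    rw [gp, ← h] at h₂; linarith
  exact dist_le_zero.1 h₃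

theorem eq_of_mem_seg {x a u v : T} (hu : u ∈ seg x a) (hv : v ∈ seg x a)
    (h : dist x u = dist x v) : u = v := by
  refine eq_of_mem_seg_of_dist_eq hu hv h ?_
  have := hu.le
  have := dist_nonneg (x := u) (y := a)
  simp only [gp, dist_self]
  linarith

theorem exists_mem_seg (x a : T) {t : ℝ} (h₀ : 0 ≤ t) (h₁ : t ≤ dist x a) :
    ∃ u ∈ seg x a, dist x u = t := by
  obtain ⟨f, hf₀, hf₁, hf⟩ := IsRTree.geodesic x a
  have h₂ := hf 0 ⟨le_rfl, dist_nonneg⟩ t ⟨h₀, h₁⟩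
  have h₃ := hf t ⟨h₀, h₁⟩ (dist x a) ⟨dist_nonneg, le_rfl⟩
  rw [hf₀, zero_sub, abs_neg, abs_of_nonneg h₀] at h₂
  rw [hf₁, abs_sub_comm, abs_of_nonneg (by linarith)] at h₃
  exact ⟨f t, by simp only [seg, mem_ofPred_eq]; linarith, h₂⟩

theorem mem_seg_of_le_gp {x a b u : T} (hu : u ∈ seg x a) (h : dist x u ≤ gp x a b) :
    u ∈ seg x b := by
  obtain ⟨v, hv, hxv⟩ := exists_mem_seg x b dist_nonneg
    (h.trans (gp_comm x a b ▸ gp_le_left x b a))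
  exact eq_of_mem_seg_of_dist_eq hu hv hxv.symm h ▸ hv

theorem le_gp_of_mem_seg {x a b u : T} (ha : u ∈ seg x a) (hb : u ∈ seg x b) :
    dist x u ≤ gp x a b := by
  have := gp_min_le x a u b
  rwa [gp_comm x a u, gp_eq_of_mem_seg ha, gp_eq_of_mem_seg hb, min_self] at this

theorem isPreconnected_seg (x a : T) : IsPreconnected (seg x a) := by
  obtain ⟨f, hf₀, hf₁, hf⟩ := IsRTree.geodesic x a
  have : seg x a = f '' Icc 0 (dist x a) := by
    ext u
    constructor
    · intro hu
      have hmem : dist x u ∈ Icc 0 (dist x a) := by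
        have := hu.le
        have := dist_nonneg (x := u) (y := a)
        exact ⟨dist_nonneg, by linarith⟩
      have h₂ := hf 0 ⟨le_rfl, dist_nonneg⟩ _ hmem
      have h₃ := hf _ hmem (dist x a) ⟨dist_nonneg, le_rfl⟩
      rw [hf₀, zero_sub, abs_neg, abs_of_nonneg hmem.1] at h₂
      rw [hf₁, abs_sub_comm, abs_of_nonneg (sub_nonneg.2 hmem.2)] at h₃
      refine ⟨dist x u, hmem, eq_of_mem_seg (a := a) (x := x) ?_ hu h₂⟩
      simp only [seg, mem_ofPred_eq]; linarith
    · rintro ⟨t, ht, rfl⟩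
      have h₂ := hf 0 ⟨le_rfl, dist_nonneg⟩ _ ht
      have h₃ := hf _ ht (dist x a) ⟨dist_nonneg, le_rfl⟩
      rw [hf₀, zero_sub, abs_neg, abs_of_nonneg ht.1] at h₂
      rw [hf₁, abs_sub_comm, abs_of_nonneg (sub_nonneg.2 ht.2)] at h₃
      simp only [seg, mem_ofPred_eq]; linarith
  rw [this]
  refine isPreconnected_Icc.image f (LipschitzOnWith.continuousOn (K := 1) ?_)
  refine LipschitzOnWith.of_dist_le_mul fun s hs t ht => ?_
  rw [hf s hs t ht, Real.dist_eq, NNReal.coe_one, one_mul]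

/-- Between two segments issued from `x` with a point `l` on the first one and not on the second
one, `p` on the segment from `l` to `y` forces `l` and `y` to branch before `l` and `p`. -/
theorem gp_le_gp_of_mem_seg {x l y p : T} (hl : l ∉ seg x y) (hp : p ∈ seg l y) (hpl : p ≠ l) :
    gp x l y ≤ gp x p l ∧ l ∉ seg x p := by
  have hly : gp x l y < dist x l := by
    by_contra h
    exact hl (mem_seg_of_le_gp (right_mem_seg x l) (not_lt.1 h))
  have hpos : 0 < dist l p := dist_pos.2 hpl.symm
  have h₁ := gp_min_le x p l y
  have h₂ := gp_min_le x p y l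
  have h₃ := gp_min_le x l p y
  have h₄ := gp_le_left x p l
  rw [gp_comm x l p] at h₃
  rw [gp_comm x y l] at h₂
  simp only [seg, mem_ofPred_eq] at hp ⊢
  simp only [gp] at *
  rw [dist_comm p l] at *
  constructor
  · by_contra! h
    rcases min_le_iff.1 h₂ with h₂ | h₂ <;> rcases min_le_iff.1 h₁ with h₁ | h₁ <;> linarith
  · intro h
    rcases min_le_iff.1 h₁ with h₁ | h₁ <;> rcases min_le_iff.1 h₃ with h₃ | h₃ <;> linarith

/-- A bridge between two disjoint subtrees is contained in every segment joining them. -/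
theorem IsBridge.mem_seg {A B : Set T} (hA : IsSubtree A) (hB : IsSubtree B) (hAB : Disjoint A B)
    {x x' : T} (h : IsBridge A B x x') {p q : T} (hp : p ∈ A) (hq : q ∈ B) : x' ∈ seg p q := by
  obtain ⟨hx, hx', hxA, hxB⟩ := h
  have key : ∀ {C : Set T} {c c' r : T}, IsSubtree C → c ∈ C → seg c c' ∩ C = {c} → r ∈ C →
      gp c r c' = 0 := by
    intro C c c' r hC hc hcc hr
    obtain ⟨m, hm, hcm⟩ := exists_mem_seg c r (gp_nonneg c r c') (gp_le_left c r c')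
    have hm' : m ∈ seg c c' ∩ C := ⟨mem_seg_of_le_gp hm hcm.le, hC c hc r hr hm⟩
    rw [hcc, mem_singleton_iff] at hm'
    rw [← hcm, hm', dist_self]
  have h₁ := key hA hx hxA hp
  have h₂ := key hB hx' (by rwa [seg_comm]) hq
  have hne : 0 < dist x x' := dist_pos.2 fun h => disjoint_left.1 hAB hx (h ▸ hx')
  rw [mem_seg_iff_gp]
  by_contra h
  have h₃ : 0 < gp x' p q := (gp_nonneg x' p q).lt_of_ne' h
  have h₄ : 0 < gp x' x p := by
    simp only [gp] at h₁ ⊢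
    rw [dist_comm x' x, dist_comm x' p, dist_comm x p] at *
    linarith
  have := gp_pos_trans h₄ h₃
  rw [gp_comm] at this
  linarith

theorem seg_image_subset_range {T' : Type*} [MetricSpace T'] [IsRTree T'] {e : T → T'}
    (he : Isometry e) (a b : T) : seg (e a) (e b) ⊆ e '' seg a b := by
  intro z hz
  have h : dist (e a) z ≤ dist a b := by
    have := hz.le
    rw [he.dist_eq] at this
    linarith [dist_nonneg (x := z) (y := e b)]
  obtain ⟨u, hu, hau⟩ := exists_mem_seg a b dist_nonneg h
  refine ⟨u, hu, eq_of_mem_seg (x := e a) (a := e b) ?_ hz (by rw [he.dist_eq, hau])⟩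
  simpa only [seg, mem_ofPred_eq, he.dist_eq] using hu

end Tree

/-! ### Rays and the Gromov boundary -/

section Rays

variable {T : Type} [MetricSpace T]

theorem Ray.dist_zero (r : Ray T) {t : ℝ} (ht : 0 ≤ t) : dist (r.1 0) (r.1 t) = t := by
  rw [r.2 0 t le_rfl ht, zero_sub, abs_neg, abs_of_nonneg ht]

theorem Ray.dist_of_le (r : Ray T) {s t : ℝ} (hs : 0 ≤ s) (hst : s ≤ t) :
    dist (r.1 s) (r.1 t) = t - s := by
  rw [r.2 s t hs (hs.trans hst), abs_sub_comm, abs_of_nonneg (sub_nonneg.2 hst)]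

theorem Ray.mem_seg (r : Ray T) {s t : ℝ} (hs : 0 ≤ s) (hst : s ≤ t) :
    r.1 s ∈ seg (r.1 0) (r.1 t) := by
  simp only [seg, mem_ofPred_eq]
  rw [r.dist_zero hs, r.dist_zero (hs.trans hst), r.dist_of_le hs hst]; ring

theorem Ray.gp_eq (r : Ray T) {s t : ℝ} (hs : 0 ≤ s) (hst : s ≤ t) :
    gp (r.1 0) (r.1 s) (r.1 t) = s := by
  rw [gp_eq_of_mem_seg (r.mem_seg hs hst), r.dist_zero hs]

theorem Ray.gp_pos (r : Ray T) {s t : ℝ} (hs : 0 < s) (ht : 0 < t) :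
    0 < gp (r.1 0) (r.1 s) (r.1 t) := by
  rcases le_total s t with h | h
  · rwa [r.gp_eq hs.le h]
  · rwa [gp_comm, r.gp_eq ht.le h]

theorem Ray.bdd_of_mk_eq {r r' : Ray T}
    (h : Quotient.mk (rayEnd T) r = Quotient.mk (rayEnd T) r') :
    ∃ C : ℝ, ∀ t : ℝ, 0 ≤ t → dist (r.1 t) (r'.1 t) ≤ C :=
  Quotient.exact h

/-- The ray obtained by forgetting the initial segment of length `a`. -/
def Ray.drop (r : Ray T) (a : ℝ) (ha : 0 ≤ a) : Ray T :=
  ⟨fun t => r.1 (a + t), fun s t hs ht => by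
    rw [r.2 _ _ (add_nonneg ha hs) (add_nonneg ha ht), add_sub_add_left_eq_sub]⟩

theorem Ray.mk_drop (r : Ray T) (a : ℝ) (ha : 0 ≤ a) :
    Quotient.mk (rayEnd T) (r.drop a ha) = Quotient.mk (rayEnd T) r :=
  Quotient.sound ⟨a, fun t ht => by
    rw [dist_comm]
    exact (r.dist_of_le ht (le_add_of_nonneg_left ha)).le.trans (by linarith)⟩

variable [IsRTree T]

theorem exists_ray_of_gp (x : T) (a : ℕ → T) (N : ℝ → ℕ)
    (H : ∀ t, 0 ≤ t → ∀ n m, N t ≤ n → N t ≤ m → t ≤ gp x (a n) (a m)) :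
    ∃ r : Ray T, r.1 0 = x ∧
      ∀ t, 0 ≤ t → ∀ n, N t ≤ n → r.1 t ∈ seg x (a n) ∧ dist x (r.1 t) = t := by
  have h₁ : ∀ t, ∃ u, 0 ≤ t → u ∈ seg x (a (N t)) ∧ dist x u = t := by
    intro t
    by_cases ht : 0 ≤ t
    · obtain ⟨u, hu⟩ := exists_mem_seg x (a (N t)) ht
        ((H t ht _ _ le_rfl le_rfl).trans (gp_le_left _ _ _))
      exact ⟨u, fun _ => hu⟩
    · exact ⟨x, fun h => absurd h ht⟩
  choose r hr using h₁
  have h₂ : ∀ t, 0 ≤ t → ∀ n, N t ≤ n → r t ∈ seg x (a n) := fun t ht n hn =>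
    mem_seg_of_le_gp (hr t ht).1 ((hr t ht).2.trans_le (H t ht _ _ le_rfl hn))
  have h₃ : ∀ s t, 0 ≤ s → s ≤ t → dist (r s) (r t) = t - s := by
    intro s t hs hst
    have ht := hs.trans hst
    obtain ⟨v, hv, hxv⟩ := exists_mem_seg x (r t) hs (hst.trans (hr t ht).2.ge)
    have hvs : v = r s := eq_of_mem_seg
      (mem_seg_trans hv (h₂ t ht (max (N s) (N t)) (le_max_right _ _)))
      (h₂ s hs _ (le_max_left _ _)) (hxv.trans (hr s hs).2.symm)
    have := hvs ▸ hv
    simp only [seg, mem_ofPred_eq] at this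
    rw [(hr s hs).2, (hr t ht).2] at this
    linarith
  refine ⟨⟨r, fun s t hs ht => ?_⟩, ?_, fun t ht n hn => ⟨h₂ t ht n hn, (hr t ht).2⟩⟩
  · rcases le_total s t with h | h
    · rw [h₃ s t hs h, abs_sub_comm, abs_of_nonneg (sub_nonneg.2 h)]
    · rw [dist_comm, h₃ t s ht h, abs_of_nonneg (sub_nonneg.2 h)]
  · exact (dist_eq_zero.1 (hr 0 le_rfl).2).symm

/-- Every end is represented by a ray issued from a given point. -/
theorem exists_ray_from (x : T) (ξ : GromovBoundary T) :
    ∃ r : Ray T, Quotient.mk (rayEnd T) r = ξ ∧ r.1 0 = x := by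
  obtain ⟨R, rfl⟩ := Quotient.exists_rep ξ
  have hlow : ∀ t, 0 ≤ t → t ≤ dist x (R.1 0) + dist x (R.1 t) := fun t ht => by
    have := dist_triangle (R.1 0) x (R.1 t)
    rwa [R.dist_zero ht, dist_comm _ x] at this
  have hup : ∀ t, 0 ≤ t → dist x (R.1 t) ≤ dist x (R.1 0) + t := fun t ht => by
    have := dist_triangle x (R.1 0) (R.1 t)
    rwa [R.dist_zero ht] at this
  obtain ⟨r, hr₀, hr⟩ := exists_ray_of_gp x (fun n => R.1 n) (fun t => ⌈t + dist x (R.1 0)⌉₊) (by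
    intro t ht n m hn hm
    have hn' := Nat.ceil_le.1 hn
    have hm' := Nat.ceil_le.1 hm
    have h₁ := hlow n n.cast_nonneg
    have h₂ := hlow m m.cast_nonneg
    rw [gp, R.2 n m n.cast_nonneg m.cast_nonneg]
    rcases abs_cases ((n : ℝ) - m) with h | h <;> linarith [h.1])
  refine ⟨r, Quotient.sound ⟨3 * dist x (R.1 0) + 2, fun t ht => ?_⟩, hr₀⟩
  have hd : 0 ≤ dist x (R.1 0) := dist_nonneg
  set n := ⌈t + dist x (R.1 0)⌉₊
  have hn₁ : t + dist x (R.1 0) ≤ n := Nat.le_ceil _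
  have hn₂ : (n : ℝ) < t + dist x (R.1 0) + 1 := Nat.ceil_lt_add_one (by linarith)
  obtain ⟨h₁, h₂⟩ := hr t ht n le_rfl
  simp only [seg, mem_ofPred_eq] at h₁
  have h₃ := R.dist_of_le ht (by linarith : t ≤ n)
  have h₄ := dist_triangle (r.1 t) (R.1 n) (R.1 t)
  rw [dist_comm (R.1 n)] at h₄
  have h₅ := hup n n.cast_nonneg
  linarith

theorem Ray.eq_of_mk_eq {r r' : Ray T}
    (h : Quotient.mk (rayEnd T) r = Quotient.mk (rayEnd T) r') (h₀ : r.1 0 = r'.1 0) {t : ℝ}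
    (ht : 0 ≤ t) : r.1 t = r'.1 t := by
  obtain ⟨C, hC⟩ := Ray.bdd_of_mk_eq h
  have hC0 : 0 ≤ C := dist_nonneg.trans (hC 0 le_rfl)
  have hs : 0 ≤ t + C := add_nonneg ht hC0
  have h₁ := r.mem_seg ht (le_add_of_nonneg_right hC0)
  have h₂ := r'.mem_seg ht (le_add_of_nonneg_right hC0)
  rw [← h₀] at h₂
  have h₃ := r'.dist_zero hs
  rw [← h₀] at h₃
  refine eq_of_mem_seg_of_dist_eq h₁ h₂ ?_ ?_
  · rw [r.dist_zero ht, h₀, r'.dist_zero ht]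
  · rw [gp, r.dist_zero ht, r.dist_zero hs, h₃]
    linarith [hC _ hs]

/-- A segment `[y,p]` followed by a ray issued from `p` in another direction is a ray. -/
theorem Ray.exists_concat (ρ : Ray T) {y : T} (h : ρ.1 0 ∈ seg y (ρ.1 1)) :
    ∃ r : Ray T, Quotient.mk (rayEnd T) r = Quotient.mk (rayEnd T) ρ ∧ r.1 0 = y ∧
      r.1 (dist y (ρ.1 0)) = ρ.1 0 := by
  obtain ⟨f, hf₀, hf₁, hf⟩ := IsRTree.geodesic y (ρ.1 0)
  have hd : 0 ≤ dist y (ρ.1 0) := dist_nonneg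
  have hyρ : ∀ t, 0 < t → dist y (ρ.1 t) = dist y (ρ.1 0) + t := by
    intro t ht
    have h₁ : ρ.1 0 ∈ seg y (ρ.1 t) := by
      by_contra h'
      rw [not_mem_seg_iff_gp] at h'
      rw [mem_seg_iff_gp] at h
      exact (gp_pos_trans h' (ρ.gp_pos ht one_pos)).ne' h
    simp only [seg, mem_ofPred_eq] at h₁
    rw [ρ.dist_zero ht.le] at h₁
    exact h₁.symm
  let r : ℝ → T := fun t => if t ≤ dist y (ρ.1 0) then f t else ρ.1 (t - dist y (ρ.1 0))
  have key : ∀ s t, 0 ≤ s → s ≤ t → dist (r s) (r t) = t - s := by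
    intro s t hs hst
    have ht := hs.trans hst
    by_cases ht' : t ≤ dist y (ρ.1 0)
    · simp only [r, if_pos ht', if_pos (hst.trans ht')]
      rw [hf s ⟨hs, hst.trans ht'⟩ t ⟨ht, ht'⟩, abs_sub_comm, abs_of_nonneg (sub_nonneg.2 hst)]
    · by_cases hs' : s ≤ dist y (ρ.1 0)
      · simp only [r, if_neg ht', if_pos hs']
        have h₁ := hf 0 ⟨le_rfl, hd⟩ s ⟨hs, hs'⟩
        have h₂ := hf s ⟨hs, hs'⟩ _ ⟨hd, le_rfl⟩
        rw [hf₀, zero_sub, abs_neg, abs_of_nonneg hs] at h₁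
        rw [hf₁, abs_sub_comm, abs_of_nonneg (sub_nonneg.2 hs')] at h₂
        have h₃ := hyρ (t - dist y (ρ.1 0)) (by linarith)
        have h₄ := dist_triangle y (f s) (ρ.1 (t - dist y (ρ.1 0)))
        have h₅ := dist_triangle (f s) (ρ.1 0) (ρ.1 (t - dist y (ρ.1 0)))
        rw [ρ.dist_zero (by linarith)] at h₅
        linarith
      · simp only [r, if_neg ht', if_neg hs']
        rw [ρ.dist_of_le (by linarith) (by linarith)]
        ring
  have hr : IsRay r := by
    intro s t hs ht
    rcases le_total s t with h | h
    · rw [key s t hs h, abs_sub_comm, abs_of_nonneg (sub_nonneg.2 h)]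
    · rw [dist_comm, key t s ht h, abs_of_nonneg (sub_nonneg.2 h)]
  refine ⟨⟨r, hr⟩, ?_, by simp [r, hf₀], by simp [r, hf₁]⟩
  have hdrop := Ray.mk_drop ⟨r, hr⟩ (dist y (ρ.1 0)) hd
  rw [← hdrop]
  refine Quotient.sound ⟨0, fun t ht => ?_⟩
  rcases ht.eq_or_lt with rfl | ht
  · simp [Ray.drop, r, hf₁]
  · simp [Ray.drop, r, ht]

theorem inl_mem_raySeg_iff {ρ : Ray T} {ξ : GromovBoundary T}
    (hξ : Quotient.mk (rayEnd T) ρ = ξ) {y : T} :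
    (Sum.inl (ρ.1 0) : TreeHat T) ∈ raySeg y ξ ↔ ρ.1 0 ∈ seg y (ρ.1 1) := by
  constructor
  · rintro (h | ⟨p, ⟨r, hr, hr₀, t, ht, hrt⟩, hp⟩)
    · exact absurd h Sum.inl_ne_inr
    · have hp' : p = ρ.1 0 := Sum.inl_injective hp
      have h := Ray.eq_of_mk_eq (r := r.drop t ht) (r' := ρ) ((r.mk_drop t ht).trans
        (hr.trans hξ.symm)) (by simp [Ray.drop, hrt, hp']) zero_le_one
      have := r.mem_seg ht (le_add_of_nonneg_right zero_le_one)
      rw [hr₀, hrt, hp'] at this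
      rw [← h]
      exact this
  · intro h
    obtain ⟨r, hr, hr₀, hrt⟩ := ρ.exists_concat h
    exact Or.inr ⟨ρ.1 0, ⟨r, hr.trans hξ, hr₀, _, dist_nonneg, hrt⟩, rfl⟩

theorem inl_mem_lineSeg_iff {ρ σ : Ray T} {ξ η : GromovBoundary T}
    (hξ : Quotient.mk (rayEnd T) ρ = ξ) (hη : Quotient.mk (rayEnd T) σ = η)
    (h₀ : ρ.1 0 = σ.1 0) :
    (Sum.inl (ρ.1 0) : TreeHat T) ∈ lineSeg ξ η ↔ ρ.1 0 ∈ seg (ρ.1 1) (σ.1 1) := by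
  constructor
  · rintro ((h | h) | ⟨p, ⟨r, r', hr, hr', hr₀, hr₀', hd⟩, hp⟩)
    · exact absurd h Sum.inl_ne_inr
    · exact absurd h Sum.inl_ne_inr
    · have hp' : p = ρ.1 0 := Sum.inl_injective hp
      have h₁ := Ray.eq_of_mk_eq (hr.trans hξ.symm) (hr₀.trans hp') zero_le_one
      have h₂ := Ray.eq_of_mk_eq (hr'.trans hη.symm) (hr₀'.trans (hp'.trans h₀)) zero_le_one
      have h₃ := hd 1 1 zero_le_one zero_le_one
      simp only [seg, mem_ofPred_eq]
      rw [← h₁, ← h₂, h₃, h₁, dist_comm, ρ.dist_zero zero_le_one, h₀, h₂, σ.dist_zero zero_le_one]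
  · intro h
    refine Or.inr ⟨ρ.1 0, ⟨ρ, σ, hξ, hη, rfl, h₀.symm, fun s t hs ht => ?_⟩, rfl⟩
    rcases hs.eq_or_lt with rfl | hs
    · rw [h₀, σ.dist_zero ht, zero_add]
    rcases ht.eq_or_lt with rfl | ht
    · rw [← h₀, dist_comm, ρ.dist_zero hs.le, add_zero]
    have h₁ : gp (ρ.1 0) (ρ.1 s) (σ.1 t) = 0 := by
      by_contra h'
      have h₂ := (gp_nonneg _ _ _).lt_of_ne' h'
      have h₃ := ρ.gp_pos one_pos hs
      have h₄ := σ.gp_pos ht one_pos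
      rw [← h₀] at h₄
      rw [mem_seg_iff_gp] at h
      exact (gp_pos_trans (gp_pos_trans h₃ h₂) h₄).ne' h
    have h₅ := σ.dist_zero ht.le
    rw [← h₀] at h₅
    rw [gp, ρ.dist_zero hs.le, h₅] at h₁
    linarith

/-- The direction at `p` determined by an end is the direction of any point of the ray from `p`
to that end. -/
theorem exists_inl_mem_segHat_iff (p : T) (s : TreeHat T) : ∃ s₀ : T, ∀ y : TreeHat T,
    ((Sum.inl p : TreeHat T) ∈ segHat s y ↔ (Sum.inl p : TreeHat T) ∈ segHat (Sum.inl s₀) y) := by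
  rcases s with s | ξ
  · exact ⟨s, fun y => Iff.rfl⟩
  obtain ⟨ρ, hρ, rfl⟩ := exists_ray_from p ξ
  refine ⟨ρ.1 1, ?_⟩
  rintro (y | η)
  · have : (Sum.inl (ρ.1 0) : TreeHat T) ∈ segHat (Sum.inl (ρ.1 1)) (Sum.inl y) ↔
        ρ.1 0 ∈ seg (ρ.1 1) y := Sum.inl_injective.mem_set_image
    rw [this, seg_comm]
    exact inl_mem_raySeg_iff hρ
  · obtain ⟨σ, hσ, hσ₀⟩ := exists_ray_from (ρ.1 0) η
    have h₁ := inl_mem_lineSeg_iff hρ hσ hσ₀.symm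
    have h₂ := inl_mem_raySeg_iff hσ (y := ρ.1 1)
    rw [hσ₀] at h₂
    exact h₁.trans h₂.symm

end Rays

/-! ### Convergence in the observers' topology -/

section Observers

variable {T : Type} [MetricSpace T] [IsRTree T]

theorem tendsto_observers {L : TreeHat T} {y : ℕ → T}
    (H : ∀ p s : T, (Sum.inl p : TreeHat T) ∉ segHat (Sum.inl s) L →
      ∀ᶠ n in atTop, p ∉ seg s (y n)) :
    Tendsto (fun n => (Sum.inl (y n) : TreeHat T)) atTop (@nhds _ (observersTopology T) L) := by
  refine TopologicalSpace.tendsto_nhds_generateFrom_iff.2 ?_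
  rintro _ ⟨P, s, hsP, rfl⟩ ⟨hLP, hL⟩
  rcases P with p | η
  · obtain ⟨s₀, hs₀⟩ := exists_inl_mem_segHat_iff p s
    filter_upwards [H p s₀ (mt (hs₀ L).2 hL)] with n hn
    have hn' : (Sum.inl p : TreeHat T) ∉ segHat (Sum.inl s₀) (Sum.inl (y n)) :=
      fun h => hn (Sum.inl_injective.mem_set_image.1 h)
    refine ⟨fun h => hn ?_, fun h => hn' ((hs₀ _).1 h)⟩
    rw [← Sum.inl_injective h]
    exact right_mem_seg _ _
  · refine Eventually.of_forall fun n => ⟨Sum.inl_ne_inr, fun h => ?_⟩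
    rcases s with s | ξ
    · obtain ⟨z, -, hz⟩ := h
      exact Sum.inl_ne_inr hz
    · rcases h with h | ⟨z, -, hz⟩
      · exact hsP (mem_singleton_iff.1 h).symm
      · exact Sum.inl_ne_inr hz

theorem tendsto_observers_inl {x l : T} {q y : ℕ → T} (hq : Tendsto q atTop (𝓝 l))
    (hql : ∀ i, q i ∈ seg x l) (hy : ∀ i, ∀ᶠ n in atTop, q i ∈ seg x (y n))
    (hl : ∀ᶠ n in atTop, l ∉ seg x (y n)) :
    Tendsto (fun n => (Sum.inl (y n) : TreeHat T)) atTop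
      (@nhds _ (observersTopology T) (Sum.inl l)) := by
  refine tendsto_observers fun p s hp => ?_
  have hp' : p ∉ seg s l := fun h => hp (mem_image_of_mem _ h)
  have hpl : p ≠ l := fun h => hp' (h ▸ right_mem_seg _ _)
  have key : ∀ n, p ∈ seg s (y n) → p ∈ seg l (y n) := by
    intro n hn
    by_contra h
    rw [not_mem_seg_iff_gp] at h hp'
    rw [mem_seg_iff_gp] at hn
    exact (gp_pos_trans hp' h).ne' hn
  by_cases hlp : l ∈ seg x p
  · filter_upwards [hl] with n hn hn'
    exact (gp_le_gp_of_mem_seg hn (key n hn') hpl).2 hlp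
  · have h₁ : gp x p l < dist x l := by
      by_contra h
      exact hlp (mem_seg_of_le_gp (right_mem_seg x l) (gp_comm x p l ▸ not_lt.1 h))
    obtain ⟨i, hi⟩ := ((tendsto_const_nhds.dist hq).eventually (lt_mem_nhds h₁)).exists
    filter_upwards [hl, hy i] with n hn hin hn'
    have h₂ := (gp_le_gp_of_mem_seg hn (key n hn') hpl).1
    have h₃ := le_gp_of_mem_seg (hql i) hin
    linarith

theorem tendsto_observers_inr {x : T} {r : Ray T} {q y : ℕ → T}
    (hqr : ∀ i, r.1 (dist x (q i)) = q i) (hq : ∀ C : ℝ, ∃ i, C < dist x (q i))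
    (hy : ∀ i, ∀ᶠ n in atTop, q i ∈ seg x (y n)) :
    Tendsto (fun n => (Sum.inl (y n) : TreeHat T)) atTop
      (@nhds _ (observersTopology T) (Sum.inr (Quotient.mk (rayEnd T) r))) := by
  refine tendsto_observers fun p s hp => ?_
  obtain ⟨ρ, hρ, rfl⟩ := exists_ray_from p (Quotient.mk (rayEnd T) r)
  obtain ⟨C, hC⟩ := Ray.bdd_of_mk_eq hρ
  have h₁ := mt (inl_mem_raySeg_iff hρ).2 hp
  obtain ⟨i, hi⟩ := hq (C + dist (ρ.1 0) x)
  have hC0 : 0 ≤ C := dist_nonneg.trans (hC 0 le_rfl)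
  have hd : 0 ≤ dist (ρ.1 0) x := dist_nonneg
  have hi0 : 0 < dist x (q i) := by linarith
  have h₂ : 0 < gp (ρ.1 0) (ρ.1 (dist x (q i))) (q i) := by
    have h₃ := hC _ hi0.le
    have h₄ := dist_triangle x (ρ.1 0) (q i)
    rw [hqr] at h₃
    rw [dist_comm x (ρ.1 0)] at h₄
    rw [gp, ρ.dist_zero hi0.le]
    linarith
  filter_upwards [hy i] with n hn hs
  have h₃ : 0 < gp (ρ.1 0) (q i) (y n) := by
    simp only [seg, mem_ofPred_eq] at hn
    have h₄ := dist_triangle x (ρ.1 0) (q i)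
    have h₅ := dist_triangle x (ρ.1 0) (y n)
    rw [dist_comm x (ρ.1 0)] at h₄ h₅
    rw [gp]
    linarith
  rw [not_mem_seg_iff_gp] at h₁
  rw [mem_seg_iff_gp] at hs
  exact (gp_pos_trans h₁ (gp_pos_trans (ρ.gp_pos one_pos hi0) (gp_pos_trans h₂ h₃))).ne' hs

/-- A sequence going away from `x` along nested segments has a limit in `T̂`, to which every
sequence of points eventually beyond each of its terms converges, unless the limit is itself a
point lying on the segments to these points. -/
theorem exists_observers_limit [CompleteSpace T] {x : T} {q : ℕ → T}
    (hq : ∀ i j, i ≤ j → q i ∈ seg x (q j)) :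
    ∃ L : TreeHat T, (∀ l, L = Sum.inl l → Tendsto q atTop (𝓝 l)) ∧
      ∀ y : ℕ → T, (∀ i, ∀ᶠ n in atTop, q i ∈ seg x (y n)) →
        (∀ l, L = Sum.inl l → ∀ᶠ n in atTop, l ∉ seg x (y n)) →
        Tendsto (fun n => (Sum.inl (y n) : TreeHat T)) atTop
          (@nhds _ (observersTopology T) L) := by
  have hmono : Monotone fun i => dist x (q i) := fun i j h => by
    have := dist_eq_of_monotone_seg hq h
    linarith [dist_nonneg (x := q i) (y := q j)]
  by_cases hb : BddAbove (range fun i => dist x (q i))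
  · have hc : CauchySeq fun i => dist x (q i) := (tendsto_atTop_ciSup hmono hb).cauchySeq
    have hc' : CauchySeq q := by
      rw [Metric.cauchySeq_iff'] at hc ⊢
      intro ε hε
      obtain ⟨N, hN⟩ := hc ε hε
      refine ⟨N, fun n hn => ?_⟩
      rw [dist_comm, dist_eq_of_monotone_seg hq hn]
      exact (le_abs_self _).trans_lt (hN n hn)
    obtain ⟨l, hl⟩ := cauchySeq_tendsto_of_complete hc'
    have hql : ∀ i, q i ∈ seg x l := mem_seg_of_tendsto hq hl
    refine ⟨Sum.inl l, fun l' h => Sum.inl_injective h ▸ hl, fun y hy hl' => ?_⟩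
    exact tendsto_observers_inl hl hql hy (hl' l rfl)
  · have hunb : ∀ C : ℝ, ∃ i, C < dist x (q i) := by
      intro C
      by_contra! h
      exact hb ⟨C, by rintro _ ⟨i, rfl⟩; exact h i⟩
    choose N hN using hunb
    obtain ⟨r, -, hr⟩ := exists_ray_of_gp x q N (by
      intro t _ n m hn hm
      have hmin : ∀ n m, N t ≤ n → n ≤ m → t ≤ gp x (q n) (q m) := fun n m hn hnm => by
        rw [gp_eq_of_mem_seg (hq n m hnm)]
        exact (hN t).le.trans (hmono hn)
      rcases le_total n m with h | h
      · exact hmin n m hn h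
      · exact gp_comm x (q n) (q m) ▸ hmin m n hm h)
    refine ⟨Sum.inr (Quotient.mk (rayEnd T) r), fun l h => absurd h.symm Sum.inl_ne_inr,
      fun y hy _ => tendsto_observers_inr (fun i => ?_) (fun C => ⟨N C, hN C⟩) hy⟩
    obtain ⟨h₁, h₂⟩ := hr (dist x (q i)) dist_nonneg (max i (N (dist x (q i)))) (le_max_right _ _)
    exact eq_of_mem_seg h₁ (hq _ _ (le_max_left _ _)) h₂

end Observers

/-! ### The pseudo-metric on `F(𝒜) × K` and points of `K ∩ wK` -/

namespace SystemOfIsometries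

theorem foldl_trans {K : Type*} (e : PartialEquiv K K) (L : List (PartialEquiv K K)) :
    L.foldl PartialEquiv.trans e = e.trans (L.foldl PartialEquiv.trans (PartialEquiv.refl K)) := by
  induction L generalizing e with
  | nil => simp
  | cons a L ih =>
    rw [List.foldl_cons, List.foldl_cons, ih (e.trans a), ih ((PartialEquiv.refl K).trans a),
      PartialEquiv.refl_trans, PartialEquiv.trans_assoc]

variable {K : Type*} [MetricSpace K] {ι : Type*} (S : SystemOfIsometries K ι)

theorem letterPE_source (z : ι × Bool) : IsClosedSubtree (S.letterPE z).source := by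
  rcases z with ⟨i, _ | _⟩
  · exact S.target_subtree i
  · exact S.source_subtree i

theorem letterPE_isom (z : ι × Bool) : ∀ x ∈ (S.letterPE z).source, ∀ y ∈ (S.letterPE z).source,
    dist (S.letterPE z x) (S.letterPE z y) = dist x y := by
  rcases z with ⟨i, _ | _⟩
  · intro x hx y hy
    have h := S.isom i _ ((S.pe i).map_target hx) _ ((S.pe i).map_target hy)
    rw [(S.pe i).right_inv hx, (S.pe i).right_inv hy] at h
    exact h.symm
  · exact S.isom i

theorem letterPE_not (z : ι × Bool) : S.letterPE (z.1, !z.2) = (S.letterPE z).symm := by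
  rcases z with ⟨i, _ | _⟩ <;> simp [letterPE]

/-- `y` is the image of `x` under the successive partial isometries of the letters of `l`. -/
def Reaches : List (ι × Bool) → K → K → Prop
  | [], x, y => x = y
  | z :: l, x, y => x ∈ (S.letterPE z).source ∧ Reaches l (S.letterPE z x) y

theorem Reaches.of_append {l l' : List (ι × Bool)} {x y : K} (h : S.Reaches (l ++ l') x y) :
    ∃ m, S.Reaches l x m := by
  induction l generalizing x with
  | nil => exact ⟨x, rfl⟩
  | cons z l ih =>
    obtain ⟨m, hm⟩ := ih h.2
    exact ⟨m, h.1, hm⟩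

theorem Reaches.admissible [DecidableEq ι] {w : FreeGroup ι} {x y : K}
    (h : S.Reaches w.toWord x y) : S.Admissible w := by
  refine ⟨x, ?_⟩
  rw [dom, wordPE]
  generalize w.toWord = l at h ⊢
  induction l generalizing x with
  | nil => simp
  | cons z l ih =>
    rw [List.map_cons, List.foldl_cons, foldl_trans, PartialEquiv.refl_trans,
      PartialEquiv.trans_source]
    exact ⟨h.1, ih h.2⟩

/-- The length of a shortest path from `x ∈ K` to `y ∈ lK` through the successive translates of
`K` by the prefixes of the word `l`. -/
def pathDist : List (ι × Bool) → K → K → ℝ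
  | [], x, y => dist x y
  | z :: l, x, y => ⨅ p : (S.letterPE z).source, dist x p + pathDist l (S.letterPE z p) y

instance (z : ι × Bool) : Nonempty (S.letterPE z).source := (S.letterPE_source z).1.to_subtype

theorem pathDist_nonneg (l : List (ι × Bool)) (x y : K) : 0 ≤ S.pathDist l x y := by
  induction l generalizing x with
  | nil => exact dist_nonneg
  | cons z l ih => exact Real.iInf_nonneg fun p => add_nonneg dist_nonneg (ih _)

theorem pathDist_cons_le (z : ι × Bool) (l : List (ι × Bool)) (x y : K) {p : K}
    (hp : p ∈ (S.letterPE z).source) :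
    S.pathDist (z :: l) x y ≤ dist x p + S.pathDist l (S.letterPE z p) y :=
  ciInf_le (f := fun p : (S.letterPE z).source => dist x p + S.pathDist l (S.letterPE z p) y)
    ⟨0, by rintro _ ⟨p, rfl⟩; exact add_nonneg dist_nonneg (S.pathDist_nonneg _ _ _)⟩ ⟨p, hp⟩

theorem le_pathDist_cons {z : ι × Bool} {l : List (ι × Bool)} {x y : K} {c : ℝ}
    (h : ∀ p ∈ (S.letterPE z).source, c ≤ dist x p + S.pathDist l (S.letterPE z p) y) :
    c ≤ S.pathDist (z :: l) x y :=
  le_ciInf fun p => h p p.2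

theorem pathDist_le_dist_add (l : List (ι × Bool)) (x x' y : K) :
    S.pathDist l x y ≤ dist x x' + S.pathDist l x' y := by
  cases l with
  | nil => exact dist_triangle _ _ _
  | cons z l =>
    rw [← sub_le_iff_le_add']
    refine S.le_pathDist_cons fun p hp => ?_
    have h₁ := S.pathDist_cons_le z l x y hp
    have h₂ := dist_triangle x x' p
    linarith

theorem pathDist_append_le (l l' : List (ι × Bool)) (x y z : K) :
    S.pathDist (l ++ l') x z ≤ S.pathDist l x y + S.pathDist l' y z := by
  induction l generalizing x with
  | nil => exact S.pathDist_le_dist_add l' x y z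
  | cons a l ih =>
    rw [← sub_le_iff_le_add]
    refine S.le_pathDist_cons fun p hp => ?_
    have h₁ := S.pathDist_cons_le a (l ++ l') x z hp
    have h₂ := ih (S.letterPE a p)
    rw [List.cons_append]
    linarith

theorem pathDist_step {l l' : List (ι × Bool)} (h : FreeGroup.Red.Step l l') (x y : K) :
    S.pathDist l' x y ≤ S.pathDist l x y := by
  obtain @⟨L₁, L₂, i, b⟩ := h
  induction L₁ generalizing x with
  | nil =>
    refine S.le_pathDist_cons fun p hp => ?_
    rw [← sub_le_iff_le_add']
    refine S.le_pathDist_cons fun q hq => ?_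
    rw [S.letterPE_not (i, b)] at hq ⊢
    have h₁ := S.letterPE_isom (i, b) p hp _ ((S.letterPE (i, b)).map_target hq)
    rw [(S.letterPE (i, b)).right_inv hq] at h₁
    have h₂ := S.pathDist_le_dist_add L₂ x ((S.letterPE (i, b)).symm q) y
    have h₃ := dist_triangle x p ((S.letterPE (i, b)).symm q)
    simp only [List.nil_append]
    linarith
  | cons z L₁ ih =>
    refine S.le_pathDist_cons fun p hp => ?_
    exact (S.pathDist_cons_le z _ x y hp).trans (add_le_add_right (ih _) _)

theorem pathDist_red {l l' : List (ι × Bool)} (h : FreeGroup.Red l l') (x y : K) :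
    S.pathDist l' x y ≤ S.pathDist l x y := by
  induction h with
  | refl => exact le_rfl
  | tail _ h ih => exact (S.pathDist_step h x y).trans ih

theorem pathDist_invRev_le (l : List (ι × Bool)) (x y : K) :
    S.pathDist (FreeGroup.invRev l) y x ≤ S.pathDist l x y := by
  induction l generalizing x with
  | nil => exact (dist_comm y x).le
  | cons z l ih =>
    refine S.le_pathDist_cons fun p hp => ?_
    rw [FreeGroup.invRev_cons]
    have h₁ := S.pathDist_append_le (FreeGroup.invRev l) (FreeGroup.invRev [z]) y
      (S.letterPE z p) x
    have h₂ := ih (S.letterPE z p)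
    have h₃ : S.pathDist [(z.1, !z.2)] (S.letterPE z p) x ≤ dist x p := by
      have hq : S.letterPE z p ∈ (S.letterPE (z.1, !z.2)).source := by
        rw [S.letterPE_not]; exact (S.letterPE z).map_source hp
      have h₄ := S.pathDist_cons_le (z.1, !z.2) [] (S.letterPE z p) x hq
      rw [dist_self, zero_add, S.letterPE_not, (S.letterPE z).left_inv hp] at h₄
      rw [dist_comm x p]
      exact h₄
    have h₄ : FreeGroup.invRev [z] = [(z.1, !z.2)] := rfl
    rw [h₄] at h₁
    rw [h₄]
    linarith

theorem pathDist_invRev (l : List (ι × Bool)) (x y : K) :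
    S.pathDist (FreeGroup.invRev l) y x = S.pathDist l x y :=
  (S.pathDist_invRev_le l x y).antisymm <| by
    simpa using S.pathDist_invRev_le (FreeGroup.invRev l) y x

theorem reaches_of_pathDist_eq_zero {l : List (ι × Bool)} {x y : K}
    (h : S.pathDist l x y = 0) : S.Reaches l x y := by
  induction l generalizing x with
  | nil => exact dist_eq_zero.1 h
  | cons z l ih =>
    have key : ∀ ε > 0, ∃ p ∈ (S.letterPE z).source,
        dist x p + S.pathDist l (S.letterPE z p) y < ε := by
      intro ε hε
      by_contra! h'
      exact hε.not_ge (h ▸ S.le_pathDist_cons h')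
    have hx : x ∈ (S.letterPE z).source := by
      rw [← (S.letterPE_source z).2.1.closure_eq, Metric.mem_closure_iff]
      intro ε hε
      obtain ⟨p, hp, hpε⟩ := key ε hε
      exact ⟨p, hp, by linarith [S.pathDist_nonneg l (S.letterPE z p) y]⟩
    refine ⟨hx, ih (le_antisymm (le_of_forall_pos_lt_add fun ε hε => ?_) (S.pathDist_nonneg _ _ _))⟩
    obtain ⟨p, hp, hpε⟩ := key ε hε
    have h₁ := S.pathDist_le_dist_add l (S.letterPE z x) (S.letterPE z p) y
    rw [S.letterPE_isom z x hx p hp] at h₁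
    linarith

end SystemOfIsometries

/-- The product `F(𝒜) × K`, whose quotient by the relation `(u, x) ∼ (ui, xi)` is a model of the
tree `T_𝒦`. -/
structure TranslateSpace {K : Type} [MetricSpace K] {ι : Type}
    (S : SystemOfIsometries K ι) where
  word : FreeGroup ι
  point : K

namespace TranslateSpace

variable {K : Type} [MetricSpace K] {ι : Type} {S : SystemOfIsometries K ι}

instance : MulAction (FreeGroup ι) (TranslateSpace S) where
  smul g p := ⟨g * p.word, p.point⟩
  one_smul p := by
    change TranslateSpace.mk (1 * p.word) p.point = p
    rw [one_mul]
  mul_smul g h p := congrArg (TranslateSpace.mk · p.point) (mul_assoc g h p.word)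

theorem smul_def (g : FreeGroup ι) (p : TranslateSpace S) : g • p = ⟨g * p.word, p.point⟩ := rfl

variable [DecidableEq ι]

instance : PseudoMetricSpace (TranslateSpace S) where
  dist p q := S.pathDist (p.word⁻¹ * q.word).toWord p.point q.point
  dist_self p := by
    rw [inv_mul_cancel, FreeGroup.toWord_one]; exact dist_self p.point
  dist_comm p q := by
    have h : p.word⁻¹ * q.word = (q.word⁻¹ * p.word)⁻¹ := by group
    rw [h, FreeGroup.toWord_inv, S.pathDist_invRev]
  dist_triangle p q r := by
    have h : p.word⁻¹ * r.word = (p.word⁻¹ * q.word) * (q.word⁻¹ * r.word) := by group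
    rw [h, FreeGroup.toWord_mul]
    exact (S.pathDist_red FreeGroup.reduce.red _ _).trans (S.pathDist_append_le _ _ _ _ _)

theorem dist_def (p q : TranslateSpace S) :
    dist p q = S.pathDist (p.word⁻¹ * q.word).toWord p.point q.point := rfl

theorem isometry_smul (g : FreeGroup ι) : Isometry fun p : TranslateSpace S => g • p := by
  refine Isometry.of_dist_eq fun p q => ?_
  simp only [dist_def, smul_def]
  congr 2
  group

instance : ContinuousConstSMul (FreeGroup ι) (TranslateSpace S) :=
  ⟨fun g => (isometry_smul g).continuous⟩

end TranslateSpace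

/-! ### Prefixes -/

theorem exists_reduced_split {ι : Type*} {C U V : List (ι × Bool)} (hU : FreeGroup.IsReduced U)
    (hV : FreeGroup.IsReduced V) (hCV : C <+: V) (hCU : ¬ C <+: U) :
    ∃ M N, FreeGroup.IsReduced (M ++ N) ∧
      FreeGroup.mk M = (FreeGroup.mk U)⁻¹ * FreeGroup.mk C ∧
      FreeGroup.mk (M ++ N) = (FreeGroup.mk U)⁻¹ * FreeGroup.mk V := by
  induction C generalizing U V with
  | nil => exact absurd List.nil_prefix hCU
  | cons z C ih =>
    obtain ⟨R, rfl⟩ := hCV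
    rcases U with _ | ⟨z', U⟩
    · exact ⟨z :: C, R, hV, by rw [← FreeGroup.one_eq_mk, inv_one, one_mul],
        by rw [← FreeGroup.one_eq_mk, inv_one, one_mul]⟩
    have hmk : ∀ (z : ι × Bool) (L : List (ι × Bool)),
        FreeGroup.mk (z :: L) = FreeGroup.mk [z] * FreeGroup.mk L := fun z L => by
      rw [FreeGroup.mul_mk]; rfl
    by_cases hz : z' = z
    · subst hz
      have hCU' : ¬ C <+: U := fun h => hCU (List.cons_prefix_cons.2 ⟨rfl, h⟩)
      obtain ⟨M, N, hMN, h₁, h₂⟩ := ih (hU.infix ⟨[z'], [], by simp⟩)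
        (hV.infix ⟨[z'], [], by simp⟩) (List.prefix_append C R) hCU'
      refine ⟨M, N, hMN, ?_, ?_⟩
      · rw [h₁, hmk z' U, hmk z' C]; group
      · rw [h₂, hmk z' U, List.cons_append, hmk z' (C ++ R)]; group
    · refine ⟨FreeGroup.invRev (z' :: U) ++ z :: C, R, ?_, ?_, ?_⟩
      · rw [List.append_assoc]
        have hinv : FreeGroup.IsReduced (FreeGroup.invRev (z' :: U)) := by
          classical
          rw [FreeGroup.isReduced_iff_reduce_eq, FreeGroup.reduce_invRev, hU.reduce_eq]
        refine List.IsChain.append hinv hV ?_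
        intro a ha b hb hab
        rw [FreeGroup.invRev_cons] at ha
        simp only [FreeGroup.invRev, List.map_cons, List.map_nil, List.reverse_cons,
          List.reverse_nil, List.nil_append, List.getLast?_append, List.getLast?_singleton,
          Option.some_or, Option.mem_def, Option.some.injEq] at ha
        simp only [List.cons_append, List.head?_cons, Option.mem_def, Option.some.injEq] at hb
        subst ha hb
        by_contra h
        refine hz (Prod.ext hab ?_)
        revert h
        cases z'.2 <;> cases z.2 <;> simp
      · rw [FreeGroup.inv_mk, FreeGroup.mul_mk]
      · rw [FreeGroup.inv_mk, FreeGroup.mul_mk, List.append_assoc]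

namespace InfWord

variable {ι : Type*} (X : InfWord ι)

theorem isReduced_ofFn (n : ℕ) :
    FreeGroup.IsReduced (List.ofFn fun i : Fin n => X.letter i) := by
  rw [FreeGroup.IsReduced, List.isChain_iff_getElem]
  intro i hi h
  simp only [List.getElem_ofFn] at h ⊢
  have := X.reduced i
  rw [LettersInv] at this
  by_contra hne
  refine this ⟨h, ?_⟩
  revert hne
  cases (X.letter i).2 <;> cases (X.letter (i + 1)).2 <;> simp

theorem prefixN_add (i n : ℕ) : X.prefixN (i + n) = X.prefixN i * (X.shift i).prefixN n := by
  rw [prefixN, prefixN, prefixN, FreeGroup.mul_mk]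
  congr 1
  rw [List.ofFn_add]
  rfl

variable [DecidableEq ι]

theorem toWord_prefixN (n : ℕ) :
    (X.prefixN n).toWord = List.ofFn fun i : Fin n => X.letter i := by
  rw [prefixN, FreeGroup.toWord_mk, (X.isReduced_ofFn n).reduce_eq]

theorem take_toWord_prefixN {i j : ℕ} (h : i ≤ j) :
    (X.prefixN j).toWord.take i = List.ofFn fun k : Fin i => X.letter k := by
  rw [toWord_prefixN]
  refine List.ext_getElem (by simpa using h) fun k _ _ => by simp

theorem prefix_of_take_eq {l : List (ι × Bool)} {i : ℕ}
    (h : l.take i = List.ofFn fun k : Fin i => X.letter k) : (X.prefixN i).toWord <+: l := by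
  rw [toWord_prefixN, ← h]
  exact List.take_prefix i l

theorem toWord_prefixN_prefix {i j : ℕ} (h : i ≤ j) :
    (X.prefixN i).toWord <+: (X.prefixN j).toWord :=
  X.prefix_of_take_eq (X.take_toWord_prefixN h)

theorem tendstoBoundary_prefixN : TendstoBoundary X.prefixN X := fun k => by
  filter_upwards [eventually_ge_atTop k] with n hn
  exact X.take_toWord_prefixN hn

theorem not_toWord_prefixN_prefix {u : FreeGroup ι} {i : ℕ} (h : u.norm < i) :
    ¬ (X.prefixN i).toWord <+: u.toWord := fun h' => by
  have := h'.length_le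
  rw [toWord_prefixN, List.length_ofFn] at this
  exact h.not_ge this

end InfWord

/-! ### Translates of `K` in the associated tree -/

namespace AssocTree

variable {K : Type} [MetricSpace K] {ι : Type} [DecidableEq ι]
  {S : SystemOfIsometries K ι} (A : AssocTree S)

theorem smul_seg {g : FreeGroup ι} {p q r : A.carrier} (h : r ∈ seg p q) :
    g • r ∈ seg (g • p) (g • q) := by
  have := (A.act_isom g).dist_eq
  simp only [seg, mem_ofPred_eq] at *
  rwa [this, this, this]

theorem isSubtree_translate (w : FreeGroup ι) : IsSubtree (w • range A.emb) := by
  intro p hp q hq r hr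
  rw [mem_smul_set_iff_inv_smul_mem] at hp hq ⊢
  exact A.emb_subtree _ hp _ hq (A.smul_seg hr)

theorem isCompact_translate [CompactSpace K] (w : FreeGroup ι) :
    IsCompact (w • range A.emb) :=
  (isCompact_range A.emb_isom.continuous).image (A.act_isom w).continuous

theorem nonempty_translate [Nonempty K] (w : FreeGroup ι) : (w • range A.emb).Nonempty :=
  (range_nonempty A.emb).smul_set

theorem emb_eq_of_letter (z : ι × Bool) {x : K} (hx : x ∈ (S.letterPE z).source) :
    A.emb x = FreeGroup.mk [z] • A.emb (S.letterPE z x) := by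
  rcases z with ⟨i, _ | _⟩
  · have h := A.compat i _ ((S.pe i).map_target hx)
    rw [(S.pe i).right_inv hx] at h
    exact h.symm
  · have h := A.compat i x hx
    rw [inv_smul_eq_iff] at h
    exact h

theorem emb_eq_of_reaches {l : List (ι × Bool)} {x y : K} (h : S.Reaches l x y) :
    A.emb x = FreeGroup.mk l • A.emb y := by
  induction l generalizing x with
  | nil =>
    rw [show x = y from h, ← FreeGroup.one_eq_mk, one_smul]
  | cons z l ih =>
    have hmk : FreeGroup.mk (z :: l) = FreeGroup.mk [z] * FreeGroup.mk l := by
      rw [FreeGroup.mul_mk]; rfl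
    rw [A.emb_eq_of_letter z h.1, ih h.2, hmk, mul_smul]

/-- Two points of `K` in the same orbit are related by the partial isometries. -/
theorem reaches_of_emb_eq {w : FreeGroup ι} {x y : K} (h : A.emb x = w • A.emb y) :
    S.Reaches w.toWord x y := by
  let e' : K → SeparationQuotient (TranslateSpace S) := fun x => SeparationQuotient.mk ⟨1, x⟩
  obtain ⟨f, ⟨-, hf, hfe⟩, -⟩ := A.universal (SeparationQuotient (TranslateSpace S))
    (fun g => Isometry.of_dist_eq fun p q => by
      obtain ⟨p, rfl⟩ := SeparationQuotient.surjective_mk p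
      obtain ⟨q, rfl⟩ := SeparationQuotient.surjective_mk q
      simp only [← SeparationQuotient.mk_smul, SeparationQuotient.dist_mk]
      exact (TranslateSpace.isometry_smul g).dist_eq p q)
    e'
    (Isometry.of_dist_eq fun x y => by
      simp only [e', SeparationQuotient.dist_mk, TranslateSpace.dist_def, inv_one, one_mul,
        FreeGroup.toWord_one]
      rfl)
    (fun i x hx => by
      simp only [e', ← SeparationQuotient.mk_smul]
      refine SeparationQuotient.mk_eq_mk.2 (Metric.inseparable_iff.2 ?_)
      simp only [TranslateSpace.dist_def, TranslateSpace.smul_def, mul_one, inv_inv,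
        FreeGroup.toWord_of]
      refine le_antisymm ?_ (S.pathDist_nonneg _ _ _)
      have := S.pathDist_cons_le (i, true) [] x (S.pe i x) hx
      rwa [dist_self, zero_add, show S.pathDist [] (S.letterPE (i, true) x) (S.pe i x) = 0 from
        dist_self _] at this)
  have h₁ : e' x = w • e' y := by rw [← hfe, ← hfe, ← hf, h]
  simp only [e', ← SeparationQuotient.mk_smul] at h₁
  have h₂ := Metric.inseparable_iff.1 (SeparationQuotient.mk_eq_mk.1 h₁)
  simp only [TranslateSpace.dist_def, TranslateSpace.smul_def, mul_one, inv_one, one_mul] at h₂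
  exact S.reaches_of_pathDist_eq_zero h₂

theorem admissible_of_not_disjoint {u w : FreeGroup ι}
    (h : ¬ Disjoint (u • range A.emb) ((u * w) • range A.emb)) : S.Admissible w := by
  obtain ⟨p, hu, hw⟩ := not_disjoint_iff.1 h
  obtain ⟨_, ⟨a, rfl⟩, rfl⟩ := mem_smul_set.1 hu
  obtain ⟨_, ⟨b, rfl⟩, hb⟩ := mem_smul_set.1 hw
  rw [mul_smul, smul_left_cancel_iff] at hb
  exact (A.reaches_of_emb_eq hb.symm).admissible

/-- If `c` lies on the segment from `u` to `v` in the Cayley tree, then `uK ∩ vK ⊆ cK`. -/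
theorem mem_translate_of_prefix {u v c : FreeGroup ι} {p : A.carrier}
    (hu : p ∈ u • range A.emb) (hv : p ∈ v • range A.emb) (hcv : c.toWord <+: v.toWord)
    (hcu : ¬ c.toWord <+: u.toWord) : p ∈ c • range A.emb := by
  obtain ⟨_, ⟨a, rfl⟩, rfl⟩ := mem_smul_set.1 hu
  obtain ⟨_, ⟨b, rfl⟩, hab⟩ := mem_smul_set.1 hv
  obtain ⟨M, N, hMN, hM, hN⟩ := exists_reduced_split FreeGroup.isReduced_toWord
    FreeGroup.isReduced_toWord hcv hcu
  simp only [FreeGroup.mk_toWord] at hM hN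
  have h₁ : A.emb a = (u⁻¹ * v) • A.emb b := by
    rw [mul_smul, hab, inv_smul_smul]
  have h₂ := A.reaches_of_emb_eq h₁
  rw [← hN, FreeGroup.toWord_mk, hMN.reduce_eq] at h₂
  obtain ⟨m, hm⟩ := h₂.of_append
  rw [A.emb_eq_of_reaches hm, hM, mul_smul, smul_inv_smul]
  exact smul_mem_smul_set (mem_range_self m)

/-- If `c` lies on the segment from `u` to `v` in the Cayley tree, then every segment from `uK` to
`vK` meets `cK`. -/
theorem exists_mem_seg_translate [CompactSpace K] {u v c : FreeGroup ι} {p q : A.carrier}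
    (hp : p ∈ u • range A.emb) (hq : q ∈ v • range A.emb) (hcv : c.toWord <+: v.toWord)
    (hcu : ¬ c.toWord <+: u.toWord) : ∃ s ∈ seg p q, s ∈ c • range A.emb := by
  have := A.tree
  obtain ⟨F, hF⟩ := A.seg_cover p q
  let P : FreeGroup ι → Prop := fun w => c.toWord <+: w.toWord
  have hclosed : ∀ G : Set (FreeGroup ι), G.Finite → IsClosed (⋃ w ∈ G, w • range A.emb) :=
    fun G hG => hG.isClosed_biUnion fun w _ => (A.isCompact_translate w).isClosed
  let G : Set (FreeGroup ι) := insert u (insert v (F : Set (FreeGroup ι)))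
  have hG : G.Finite := (F.finite_toSet.insert v).insert u
  obtain ⟨s, hs, hs₁, hs₂⟩ := isPreconnected_closed_iff.1 (isPreconnected_seg p q)
    (⋃ w ∈ G ∩ {w | ¬ P w}, w • range A.emb) (⋃ w ∈ G ∩ {w | P w}, w • range A.emb)
    (hclosed _ (hG.inter_of_left _)) (hclosed _ (hG.inter_of_left _))
    (fun s hs => by
      obtain ⟨w, hw, hsw⟩ := mem_iUnion₂.1 (hF hs)
      have hwG : w ∈ G := Or.inr (Or.inr hw)
      by_cases h : P w
      · exact Or.inr (mem_iUnion₂.2 ⟨w, ⟨hwG, h⟩, hsw⟩)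
      · exact Or.inl (mem_iUnion₂.2 ⟨w, ⟨hwG, h⟩, hsw⟩))
    ⟨p, left_mem_seg p q, mem_iUnion₂.2 ⟨u, ⟨Or.inl rfl, hcu⟩, hp⟩⟩
    ⟨q, right_mem_seg p q, mem_iUnion₂.2 ⟨v, ⟨Or.inr (Or.inl rfl), hcv⟩, hq⟩⟩
  obtain ⟨u', ⟨-, hu'⟩, hsu⟩ := mem_iUnion₂.1 hs₁
  obtain ⟨v', ⟨-, hv'⟩, hsv⟩ := mem_iUnion₂.1 hs₂
  exact ⟨s, hs, A.mem_translate_of_prefix hsu hsv hv' hu'⟩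

end AssocTree

namespace AssocTree

variable {K : Type} [MetricSpace K] {ι : Type} [DecidableEq ι]
  {S : SystemOfIsometries K ι} (A : AssocTree S)

theorem admissible_of_mem_translate_prefix (X : InfWord ι) (i n : ℕ) {p : A.carrier}
    (h₁ : p ∈ X.prefixN i • range A.emb) (h₂ : p ∈ X.prefixN (i + n) • range A.emb) :
    S.Admissible ((X.shift i).prefixN n) :=
  A.admissible_of_not_disjoint (u := X.prefixN i)
    (not_disjoint_iff.2 ⟨p, h₁, X.prefixN_add i n ▸ h₂⟩)

/-- The translates `XᵢK` leave every translate of `K` when `X` is not eventually admissible. -/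
theorem eventually_disjoint_translate {X : InfWord ι} (hX : ¬ S.EventuallyAdmissible X)
    (u : FreeGroup ι) :
    ∀ᶠ i in atTop, Disjoint (u • range A.emb) (X.prefixN i • range A.emb) := by
  simp only [SystemOfIsometries.EventuallyAdmissible, SystemOfIsometries.AdmissibleInf,
    not_exists, not_forall] at hX
  obtain ⟨n, hn⟩ := hX (u.norm + 1)
  filter_upwards [eventually_ge_atTop (u.norm + 1 + n)] with i hi
  refine disjoint_left.2 fun p hu hp => hn ?_
  refine A.admissible_of_mem_translate_prefix X _ n
    (A.mem_translate_of_prefix hu hp (X.toWord_prefixN_prefix (by omega))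
      (X.not_toWord_prefixN_prefix (by omega)))
    (A.mem_translate_of_prefix hu hp (X.toWord_prefixN_prefix hi)
      (X.not_toWord_prefixN_prefix (by omega)))

theorem mem_seg_of_isBridge [CompactSpace K] {X : InfWord ι} {i : ℕ} (hi : 0 < i)
    (hd : Disjoint (range A.emb) (X.prefixN i • range A.emb)) {x x' : A.carrier}
    (h : IsBridge (range A.emb) (X.prefixN i • range A.emb) x x') {w : FreeGroup ι}
    (hw : (X.prefixN i).toWord <+: w.toWord) {p z : A.carrier} (hp : p ∈ range A.emb)
    (hz : z ∈ w • range A.emb) : x' ∈ seg p z := by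
  have := A.tree
  obtain ⟨s, hs, hsi⟩ := A.exists_mem_seg_translate (u := 1) (by rwa [one_smul]) hz hw
    (X.not_toWord_prefixN_prefix (by rwa [FreeGroup.norm_one]))
  exact mem_seg_trans (h.mem_seg A.emb_subtree (A.isSubtree_translate _) hd hp hsi) hs

end AssocTree

/-- **Proposition 4.3.**  Let `X ∈ ∂F(𝒜)` be not eventually admissible.  Then the terminal
points `Qᵢ` of the nested segments `[K, XᵢK]` (over the indices `i` with `Xᵢ`
non-admissible, so that `K` and `XᵢK` are disjoint — such indices eventually exist, as do
the bridges) converge in `T̂_𝒦` (observers' topology) to a point `𝒬_𝒦(X)`; every sequence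
of points `Pₙ ∈ wₙK` with `wₙ → X` converges to `𝒬_𝒦(X)`; and `𝒬_𝒦(X) ∈ T̂_𝒦 ∖ T_𝒦`.
Here `T̄_𝒦` is represented by a completion `(Tc, e)` of `T_𝒦`. -/
theorem QK_not_eventually_admissible (K : Type) [MetricSpace K] [CompactSpace K] [IsRTree K]
    (ι : Type) [Fintype ι] [DecidableEq ι] (S : SystemOfIsometries K ι)
    (A : AssocTree S)
    (Tc : Type) [MetricSpace Tc] [CompleteSpace Tc] (hTc : IsRTree Tc)
    (e : A.carrier → Tc) (he : Isometry e) (hdense : DenseRange e)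
    (X : InfWord ι) (hX : ¬ S.EventuallyAdmissible X) :
    ∃ L : TreeHat Tc,
      L ∉ Sum.inl '' Set.range e ∧
      (∀ᶠ i in Filter.atTop, ∃ x x' : A.carrier,
        IsBridge (Set.range A.emb) (X.prefixN i • Set.range A.emb) x x') ∧
      (∀ Q : ℕ → A.carrier,
        (∀ᶠ i in Filter.atTop, ∃ x : A.carrier,
          IsBridge (Set.range A.emb) (X.prefixN i • Set.range A.emb) x (Q i)) →
        Filter.Tendsto (fun i => (Sum.inl (e (Q i)) : TreeHat Tc)) Filter.atTop
          (@nhds _ (observersTopology Tc) L)) ∧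
      (∀ (w : ℕ → FreeGroup ι) (P : ℕ → A.carrier), TendstoBoundary w X →
        (∀ n, P n ∈ w n • Set.range A.emb) →
        Filter.Tendsto (fun n => (Sum.inl (e (P n)) : TreeHat Tc)) Filter.atTop
          (@nhds _ (observersTopology Tc) L)) := by
  obtain ⟨k₀, -⟩ := (S.source_subtree (X.letter 0).1).1
  have : Nonempty K := ⟨k₀⟩
  have := A.tree
  obtain ⟨i₀, hi₀⟩ := eventually_atTop.1
    ((A.eventually_disjoint_translate hX 1).and (eventually_gt_atTop 0))
  simp only [one_smul] at hi₀
  have hbridge : ∀ i, ∃ x x' : A.carrier,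
      IsBridge (range A.emb) (X.prefixN i • range A.emb) x x' := fun i =>
    exists_isBridge (isCompact_range A.emb_isom.continuous) (A.isCompact_translate _)
      (range_nonempty _) (A.nonempty_translate _)
  choose x q hq using fun j => hbridge (i₀ + j)
  have hgate : ∀ j {w : FreeGroup ι} {z : A.carrier}, (X.prefixN (i₀ + j)).toWord <+: w.toWord →
      z ∈ w • range A.emb → q j ∈ seg (A.emb k₀) z := fun j w z hw hz =>
    A.mem_seg_of_isBridge (hi₀ _ (by omega)).2 (hi₀ _ (by omega)).1 (hq j) hw
      (mem_range_self k₀) hz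
  have hmem : ∀ j, q j ∈ X.prefixN (i₀ + j) • range A.emb := fun j => (hq j).2.1
  have hmono : ∀ i j, i ≤ j → q i ∈ seg (A.emb k₀) (q j) := fun i j hij =>
    hgate i (X.toWord_prefixN_prefix (by omega)) (hmem j)
  have hmap : ∀ {a b c : A.carrier}, a ∈ seg b c → e a ∈ seg (e b) (e c) := fun h => by
    simpa only [seg, mem_ofPred_eq, he.dist_eq] using h
  obtain ⟨L, hL₁, hL₂⟩ := exists_observers_limit (x := e (A.emb k₀)) (q := e ∘ q)
    fun i j hij => hmap (hmono i j hij)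
  have hLnot : ∀ p, L ≠ Sum.inl (e p) := by
    intro p hp
    have hlim : Tendsto q atTop (𝓝 p) := he.isEmbedding.tendsto_nhds_iff.2 (hL₁ _ hp)
    obtain ⟨F, hF⟩ := A.seg_cover (A.emb k₀) p
    have h := (eventually_all_finset F).2 fun u _ => A.eventually_disjoint_translate hX u
    obtain ⟨j, hj⟩ := ((tendsto_add_atTop_nat i₀).eventually h).exists
    obtain ⟨u, hu, hqu⟩ := mem_iUnion₂.1 (hF (mem_seg_of_tendsto hmono hlim j))
    rw [add_comm] at hj
    exact disjoint_left.1 (hj u hu) hqu (hmem j)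
  have hconv : ∀ (w : ℕ → FreeGroup ι) (P : ℕ → A.carrier), TendstoBoundary w X →
      (∀ᶠ n in atTop, P n ∈ w n • range A.emb) →
      Tendsto (fun n => (Sum.inl (e (P n)) : TreeHat Tc)) atTop
        (@nhds _ (observersTopology Tc) L) := by
    intro w P hw hP
    refine hL₂ (fun n => e (P n)) (fun i => ?_) fun l hl => Eventually.of_forall fun n hn => ?_
    · filter_upwards [hw (i₀ + i), hP] with n hn hPn
      exact hmap (hgate i (X.prefix_of_take_eq hn) hPn)
    · obtain ⟨p, -, rfl⟩ := seg_image_subset_range he _ _ hn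
      exact hLnot p hl
  refine ⟨L, ?_, Eventually.of_forall hbridge, fun Q hQ => ?_, fun w P hw hP =>
    hconv w P hw (Eventually.of_forall hP)⟩
  · rintro ⟨_, ⟨p, rfl⟩, rfl⟩
    exact hLnot p rfl
  · refine hconv _ Q X.tendstoBoundary_prefixN (hQ.mono ?_)
    rintro i ⟨x, hx⟩
    exact hx.2.1

end CHL
end
end

section
/- Let 𝒦 = (K,𝒜) be a system of isometries with independent generators, and let X ∈ ∂F(𝒜) be an eventually admissible word. Then for every point P ∈ T_𝒦 and every sequence wₙ of elements of F(𝒜) converging in F(𝒜) ∪ ∂F(𝒜) to X, the sequence of points wₙP converges to 𝒬_𝒦(X) with respect to the observers' topology on T̂_𝒦. -/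
/-!
Common formalization framework for "ℝ-trees, dual laminations, and compact systems
of partial isometries" (Coulbois–Hilion–Lustig).
-/

open Set Filter Topology Pointwise

noncomputable section

namespace CHL

namespace SystemOfIsometries

variable {K : Type*} [MetricSpace K] {ι : Type*} (S : SystemOfIsometries K ι)

/-! ### The partial isometries of letters and of (not necessarily reduced) words -/

theorem letterPE_not_s15 (c : ι × Bool) : S.letterPE (c.1, !c.2) = (S.letterPE c).symm := by
  rcases c with ⟨i, _ | _⟩ <;> simp [letterPE]

theorem isClosedSubtree_source_letterPE (c : ι × Bool) :
    IsClosedSubtree (S.letterPE c).source := by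
  rcases c with ⟨i, _ | _⟩
  · exact S.target_subtree i
  · exact S.source_subtree i

theorem dist_letterPE (c : ι × Bool) {x y : K} (hx : x ∈ (S.letterPE c).source)
    (hy : y ∈ (S.letterPE c).source) :
    dist (S.letterPE c x) (S.letterPE c y) = dist x y := by
  rcases c with ⟨i, _ | _⟩
  · have h := S.isom i _ ((S.pe i).map_target hx) _ ((S.pe i).map_target hy)
    rw [(S.pe i).right_inv hx, (S.pe i).right_inv hy] at h
    exact h.symm
  · exact S.isom i x hx y hy

instance nonempty_source_letterPE (c : ι × Bool) : Nonempty (S.letterPE c).source :=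
  (S.isClosedSubtree_source_letterPE c).1.to_subtype

/-- The partial isometry associated to a word that need not be reduced. -/
def listPE : List (ι × Bool) → PartialEquiv K K
  | [] => PartialEquiv.refl K
  | c :: L => (S.letterPE c).trans (listPE L)

theorem foldl_letterPE (L : List (ι × Bool)) (f : PartialEquiv K K) :
    (L.map S.letterPE).foldl PartialEquiv.trans f = f.trans (S.listPE L) := by
  induction L generalizing f with
  | nil => simp [listPE]
  | cons c L ih => simp [listPE, ih, PartialEquiv.trans_assoc]

theorem wordPE_eq_listPE [DecidableEq ι] (w : FreeGroup ι) : S.wordPE w = S.listPE w.toWord := by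
  rw [wordPE, foldl_letterPE, PartialEquiv.refl_trans]

theorem listPE_append (L M : List (ι × Bool)) :
    S.listPE (L ++ M) = (S.listPE L).trans (S.listPE M) := by
  induction L with
  | nil => simp [listPE]
  | cons c L ih => simp [listPE, ih, PartialEquiv.trans_assoc]

/-! ### The pseudo-metric on `F(𝒜) × K` -/

/-- The length of a shortest path from `x` to `y` in the space obtained by gluing copies of `K`
along the word `L`. -/
def glueDist : List (ι × Bool) → K → K → ℝ
  | [], x, y => dist x y
  | c :: L, x, y => ⨅ p : (S.letterPE c).source, (dist x p + glueDist L (S.letterPE c p) y)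

theorem glueDist_nonneg (L : List (ι × Bool)) (x y : K) : 0 ≤ S.glueDist L x y := by
  induction L generalizing x with
  | nil => exact dist_nonneg
  | cons c L ih => exact Real.iInf_nonneg fun p => add_nonneg dist_nonneg (ih _)

theorem bddBelow_glueDist (c : ι × Bool) (L : List (ι × Bool)) (x y : K) :
    BddBelow (range fun p : (S.letterPE c).source =>
      dist x p + S.glueDist L (S.letterPE c p) y) := by
  refine ⟨0, ?_⟩
  rintro _ ⟨p, rfl⟩
  exact add_nonneg dist_nonneg (S.glueDist_nonneg _ _ _)

theorem glueDist_cons_le {c : ι × Bool} (L : List (ι × Bool)) (x y : K) {p : K}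
    (hp : p ∈ (S.letterPE c).source) :
    S.glueDist (c :: L) x y ≤ dist x p + S.glueDist L (S.letterPE c p) y :=
  ciInf_le (S.bddBelow_glueDist c L x y) ⟨p, hp⟩

theorem le_glueDist_cons {c : ι × Bool} {L : List (ι × Bool)} {x y : K} {r : ℝ}
    (h : ∀ p ∈ (S.letterPE c).source, r ≤ dist x p + S.glueDist L (S.letterPE c p) y) :
    r ≤ S.glueDist (c :: L) x y :=
  le_ciInf fun p => h p p.2

theorem glueDist_le_dist_add (L : List (ι × Bool)) (x y z : K) :
    S.glueDist L x z ≤ dist x y + S.glueDist L y z := by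
  cases L with
  | nil => exact dist_triangle _ _ _
  | cons c L =>
    rw [← sub_le_iff_le_add']
    refine S.le_glueDist_cons fun p hp => ?_
    linarith [S.glueDist_cons_le L x z hp, dist_triangle x y p]

theorem glueDist_append_le (L M : List (ι × Bool)) (x y z : K) :
    S.glueDist (L ++ M) x z ≤ S.glueDist L x y + S.glueDist M y z := by
  induction L generalizing x with
  | nil => exact S.glueDist_le_dist_add M x y z
  | cons c L ih =>
    rw [← sub_le_iff_le_add]
    refine S.le_glueDist_cons fun p hp => ?_
    rw [List.cons_append]
    linarith [S.glueDist_cons_le (L ++ M) x z hp, ih (S.letterPE c p)]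

theorem glueDist_le_of_step {L M : List (ι × Bool)} (h : FreeGroup.Red.Step L M) (x y : K) :
    S.glueDist M x y ≤ S.glueDist L x y := by
  obtain @⟨L₁, L₂, i, b⟩ := h
  induction L₁ generalizing x with
  | nil =>
    refine S.le_glueDist_cons fun p hp => ?_
    rw [← sub_le_iff_le_add']
    refine S.le_glueDist_cons fun p' hp' => ?_
    have hinv := S.letterPE_not_s15 (i, b)
    simp only at hinv
    rw [hinv] at hp' ⊢
    have h₁ := S.dist_letterPE (i, b) hp ((S.letterPE (i, b)).map_target hp')
    rw [(S.letterPE (i, b)).right_inv hp'] at h₁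
    have h₂ := S.glueDist_le_dist_add L₂ x ((S.letterPE (i, b)).symm p') y
    have h₃ := dist_triangle x p ((S.letterPE (i, b)).symm p')
    simp only [List.nil_append]
    linarith
  | cons c L₁ ih =>
    refine S.le_glueDist_cons fun p hp => ?_
    exact (S.glueDist_cons_le _ x y hp).trans (add_le_add_right (ih _) _)

theorem glueDist_le_of_red {L M : List (ι × Bool)} (h : FreeGroup.Red L M) (x y : K) :
    S.glueDist M x y ≤ S.glueDist L x y := by
  induction h with
  | refl => exact le_rfl
  | tail _ h ih => exact (S.glueDist_le_of_step h x y).trans ih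

theorem glueDist_invRev_le (L : List (ι × Bool)) (x y : K) :
    S.glueDist (FreeGroup.invRev L) y x ≤ S.glueDist L x y := by
  induction L generalizing x with
  | nil => exact (dist_comm _ _).le
  | cons c L ih =>
    refine S.le_glueDist_cons fun p hp => ?_
    have hL : FreeGroup.invRev (c :: L) = FreeGroup.invRev L ++ [(c.1, !c.2)] := by
      simp [FreeGroup.invRev]
    have hp' : S.letterPE c p ∈ (S.letterPE (c.1, !c.2)).source := by
      rw [S.letterPE_not_s15]
      exact (S.letterPE c).map_source hp
    have h₁ := S.glueDist_cons_le [] (S.letterPE c p) x hp'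
    rw [dist_self, zero_add, S.letterPE_not_s15, (S.letterPE c).left_inv hp] at h₁
    have h₂ := S.glueDist_append_le (FreeGroup.invRev L) [(c.1, !c.2)] y (S.letterPE c p) x
    have h₃ : S.glueDist [] p x = dist x p := dist_comm _ _
    rw [hL]
    linarith [ih (S.letterPE c p)]

theorem glueDist_invRev (L : List (ι × Bool)) (x y : K) :
    S.glueDist (FreeGroup.invRev L) y x = S.glueDist L x y := by
  refine (S.glueDist_invRev_le L x y).antisymm ?_
  simpa using S.glueDist_invRev_le (FreeGroup.invRev L) y x

theorem continuous_glueDist (L : List (ι × Bool)) (y : K) :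
    Continuous fun x => S.glueDist L x y := by
  refine (LipschitzWith.of_le_add fun x z => ?_).continuous
  rw [add_comm]
  exact S.glueDist_le_dist_add L x z y

theorem continuousOn_letterPE (c : ι × Bool) :
    ContinuousOn (S.letterPE c) (S.letterPE c).source := by
  refine LipschitzOnWith.continuousOn (K := 1) (LipschitzOnWith.of_dist_le_mul fun x hx y hy => ?_)
  simp [S.dist_letterPE c hx hy]

theorem mem_source_of_glueDist_eq_zero [CompactSpace K] (L : List (ι × Bool)) (x y : K)
    (h : S.glueDist L x y = 0) : x ∈ (S.listPE L).source ∧ S.listPE L x = y := by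
  induction L generalizing x with
  | nil => exact ⟨mem_univ _, dist_eq_zero.1 h⟩
  | cons c L ih =>
    obtain ⟨hne, hcl, -⟩ := S.isClosedSubtree_source_letterPE c
    obtain ⟨p, hp, hmin⟩ := hcl.isCompact.exists_isMinOn hne
      (f := fun p => dist x p + S.glueDist L (S.letterPE c p) y)
      ((continuous_const.dist continuous_id).continuousOn.add
        ((S.continuous_glueDist L y).comp_continuousOn (S.continuousOn_letterPE c)))
    have hle : dist x p + S.glueDist L (S.letterPE c p) y ≤ 0 :=
      h ▸ S.le_glueDist_cons fun p' hp' => isMinOn_iff.1 hmin p' hp'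
    have hnonneg := S.glueDist_nonneg L (S.letterPE c p) y
    have hx : x = p := dist_eq_zero.1 (by linarith [dist_nonneg (x := x) (y := p)])
    subst hx
    obtain ⟨h₁, h₂⟩ := ih _ (by linarith [dist_nonneg (x := x) (y := x)])
    exact ⟨⟨hp, h₁⟩, h₂⟩

/-- The set `F(𝒜) × K` with the pseudo-metric whose quotient metric space is the space obtained by
gluing the copies `{u} × K` along the partial isometries in `𝒜`. -/
def Glued (_ : SystemOfIsometries K ι) : Type _ := FreeGroup ι × K

variable [DecidableEq ι]

instance : PseudoMetricSpace S.Glued where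
  dist a b := S.glueDist (a.1⁻¹ * b.1).toWord a.2 b.2
  dist_self a := by
    simp [glueDist]
  dist_comm a b := by
    rw [← S.glueDist_invRev, ← FreeGroup.toWord_inv, mul_inv_rev, inv_inv]
  dist_triangle a b c := by
    have h : a.1⁻¹ * c.1 = (a.1⁻¹ * b.1) * (b.1⁻¹ * c.1) := by group
    rw [h, FreeGroup.toWord_mul]
    exact (S.glueDist_le_of_red FreeGroup.reduce.red _ _).trans (S.glueDist_append_le _ _ _ _ _)

theorem dist_glued (u v : FreeGroup ι) (x y : K) :
    dist (α := S.Glued) (u, x) (v, y) = S.glueDist (u⁻¹ * v).toWord x y := rfl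

instance : MulAction (FreeGroup ι) S.Glued where
  smul g a := (g * a.1, a.2)
  one_smul _ := Prod.ext (one_mul _) rfl
  mul_smul _ _ _ := Prod.ext (mul_assoc _ _ _) rfl

theorem isometry_smul_glued (g : FreeGroup ι) : Isometry fun a : S.Glued => g • a := by
  refine Isometry.of_dist_eq fun a b => ?_
  change S.glueDist ((g * a.1)⁻¹ * (g * b.1)).toWord a.2 b.2 = _
  rw [show (g * a.1)⁻¹ * (g * b.1) = a.1⁻¹ * b.1 by group]
  rfl

instance : ContinuousConstSMul (FreeGroup ι) S.Glued :=
  ⟨fun g => (S.isometry_smul_glued g).continuous⟩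

end SystemOfIsometries

open SystemOfIsometries

namespace AssocTree

variable {K : Type} [MetricSpace K] {ι : Type} [DecidableEq ι] {S : SystemOfIsometries K ι}
  (A : AssocTree S)

/-- Two translates of points of `K` coincide in `T_𝒦` only if they are identified by the partial
isometries of the system. -/
theorem mem_dom_of_smul_emb_eq [CompactSpace K] {g h : FreeGroup ι} {x y : K}
    (hxy : g • A.emb x = h • A.emb y) : x ∈ S.dom (g⁻¹ * h) := by
  let e' : K → SeparationQuotient S.Glued := fun x => SeparationQuotient.mk (1, x)
  have hact (u : FreeGroup ι) : Isometry fun a : SeparationQuotient S.Glued => u • a := by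
    refine Isometry.of_dist_eq fun a b => ?_
    obtain ⟨a, rfl⟩ := SeparationQuotient.surjective_mk a
    obtain ⟨b, rfl⟩ := SeparationQuotient.surjective_mk b
    exact (S.isometry_smul_glued u).dist_eq a b
  have he' : Isometry e' := by
    refine Isometry.of_dist_eq fun x y => ?_
    change dist (α := S.Glued) (1, x) (1, y) = dist x y
    simp [dist_glued, glueDist]
  obtain ⟨f, ⟨-, hequiv, hemb⟩, -⟩ := A.universal (SeparationQuotient S.Glued) hact e' he' <| by
    intro i x hx
    rw [← dist_le_zero]
    change dist (α := S.Glued) ((FreeGroup.of i)⁻¹ * 1, x) (1, S.pe i x) ≤ 0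
    rw [dist_glued]
    have h := S.glueDist_cons_le (c := (i, true)) [] x (S.pe i x) (p := x) hx
    simpa [letterPE, glueDist] using h
  have heq := congrArg f hxy
  rw [hequiv, hequiv, hemb, hemb] at heq
  have hz : dist (α := S.Glued) (g * 1, x) (h * 1, y) = 0 := dist_eq_zero.2 heq
  rw [dist_glued, mul_one, mul_one] at hz
  rw [SystemOfIsometries.dom, wordPE_eq_listPE]
  exact (S.mem_source_of_glueDist_eq_zero _ _ _ hz).1

end AssocTree

/-! ### Prefixes of reduced words -/

section Words

variable {ι : Type*}

theorem InfWord.isReduced_ofFn_s15 (X : InfWord ι) (n : ℕ) :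
    FreeGroup.IsReduced (List.ofFn fun i : Fin n => X.letter i) := by
  refine List.isChain_iff_getElem.2 fun i hi => ?_
  have h := X.reduced i
  simp only [List.getElem_ofFn]
  intro h₁
  by_contra h₂
  exact h ⟨h₁, by simpa using Bool.eq_not.2 h₂⟩

theorem InfWord.ofFn_succ (X : InfWord ι) (n : ℕ) :
    (List.ofFn fun i : Fin (n + 1) => X.letter i) =
      (List.ofFn fun i : Fin n => X.letter i) ++ [X.letter n] := by
  rw [List.ofFn_succ_last]
  rfl

theorem InfWord.prefixN_succ (X : InfWord ι) (n : ℕ) :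
    X.prefixN (n + 1) = X.prefixN n * FreeGroup.mk [X.letter n] := by
  rw [prefixN, ofFn_succ, ← FreeGroup.mul_mk, prefixN]

theorem InfWord.prefixN_add_s15 (X : InfWord ι) (m n : ℕ) :
    X.prefixN (m + n) = X.prefixN m * (X.shift m).prefixN n := by
  induction n with
  | zero => simp [prefixN, ← FreeGroup.one_eq_mk]
  | succ n ih => rw [← add_assoc, prefixN_succ, prefixN_succ, ih, mul_assoc]; rfl

variable [DecidableEq ι]

theorem toWord_mk_of_isReduced {L : List (ι × Bool)} (h : FreeGroup.IsReduced L) :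
    (FreeGroup.mk L).toWord = L := by
  rw [FreeGroup.toWord_mk, h.reduce_eq]

/-- If the reduced word of `X_m⁻¹ g` starts with the `m`-th letter of `X`, then the product
`X_m · (X_m⁻¹ g)` is reduced. -/
theorem InfWord.toWord_eq_append (X : InfWord ι) (m : ℕ) (g : FreeGroup ι)
    (h : ((X.prefixN m)⁻¹ * g).toWord.head? = some (X.letter m)) :
    g.toWord = (List.ofFn fun i : Fin m => X.letter i) ++ ((X.prefixN m)⁻¹ * g).toWord := by
  obtain ⟨L, hL⟩ := List.head?_eq_some_iff.1 h
  have hred : FreeGroup.IsReduced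
      ((List.ofFn fun i : Fin m => X.letter i) ++ [X.letter m] ++ L) := by
    refine FreeGroup.IsReduced.append_overlap ?_ ?_ (by simp)
    · rw [← X.ofFn_succ]
      exact X.isReduced_ofFn_s15 _
    · rw [List.singleton_append, ← hL]
      exact FreeGroup.isReduced_toWord
  have hg : g = FreeGroup.mk ((List.ofFn fun i : Fin m => X.letter i) ++ [X.letter m] ++ L) := by
    have h' : (X.prefixN m)⁻¹ * g = FreeGroup.mk (X.letter m :: L) := by
      rw [← hL, FreeGroup.mk_toWord]
    rw [List.append_assoc, List.singleton_append, ← FreeGroup.mul_mk, ← h']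
    exact (mul_inv_cancel_left (X.prefixN m) g).symm
  conv_lhs => rw [hg, toWord_mk_of_isReduced hred]
  rw [hL, List.append_assoc, List.singleton_append]

theorem InfWord.head?_ne_of_norm_le (X : InfWord ι) {m : ℕ} {g : FreeGroup ι} (h : g.norm ≤ m) :
    ((X.prefixN m)⁻¹ * g).toWord.head? ≠ some (X.letter m) := by
  intro hhead
  have hlen := congrArg List.length (X.toWord_eq_append m g hhead)
  obtain ⟨L, hL⟩ := List.head?_eq_some_iff.1 hhead
  rw [hL] at hlen
  simp only [List.length_append, List.length_ofFn, List.length_cons] at hlen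
  rw [FreeGroup.norm] at h
  omega

theorem InfWord.head?_eq_of_take_eq (X : InfWord ι) {m : ℕ} {g : FreeGroup ι}
    (h : g.toWord.take (m + 1) = List.ofFn fun i : Fin (m + 1) => X.letter i) :
    ((X.prefixN m)⁻¹ * g).toWord.head? = some (X.letter m) := by
  have hg : g.toWord = (List.ofFn fun i : Fin m => X.letter i) ++
      (X.letter m :: g.toWord.drop (m + 1)) := by
    conv_lhs => rw [← List.take_append_drop (m + 1) g.toWord, h, X.ofFn_succ]
    simp
  have hinv : (X.prefixN m)⁻¹ * g = FreeGroup.mk (X.letter m :: g.toWord.drop (m + 1)) := by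
    rw [inv_mul_eq_iff_eq_mul, prefixN, FreeGroup.mul_mk, ← hg, FreeGroup.mk_toWord]
  have hred : FreeGroup.IsReduced (X.letter m :: g.toWord.drop (m + 1)) :=
    (FreeGroup.isReduced_toWord (x := g)).infix (⟨_, [], by simpa using hg.symm⟩)
  rw [hinv, toWord_mk_of_isReduced hred]
  rfl

theorem take_toWord_mul_mk_singleton {k : ℕ} {w : FreeGroup ι} (hw : k < w.toWord.length)
    (c : ι × Bool) : (w * FreeGroup.mk [c]).toWord.take k = w.toWord.take k := by
  obtain ⟨L, d, hL⟩ : ∃ L d, w.toWord = L ++ [d] :=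
    ⟨_, _, (List.dropLast_append_getLast (List.ne_nil_of_length_pos (by omega))).symm⟩
  have hred : FreeGroup.IsReduced (L ++ [d]) := hL ▸ FreeGroup.isReduced_toWord
  have hk : k ≤ L.length := by
    rw [hL] at hw
    simpa [Nat.lt_succ_iff] using hw
  have hmul : w * FreeGroup.mk [c] = FreeGroup.mk (L ++ [d] ++ [c]) := by
    rw [← FreeGroup.mul_mk, ← hL, FreeGroup.mk_toWord]
  rw [hmul, hL, List.take_append_of_le_length hk]
  by_cases hdc : d.1 = c.1 → d.2 = c.2
  · rw [toWord_mk_of_isReduced (hred.append_overlap (by simpa using hdc) (by simp)),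
      List.append_assoc, List.take_append_of_le_length hk]
  · push Not at hdc
    obtain rfl : c = (d.1, !d.2) := Prod.ext hdc.1.symm (Bool.eq_not.2 hdc.2.symm)
    have hstep : FreeGroup.mk (L ++ [d] ++ [(d.1, !d.2)]) = FreeGroup.mk L := by
      have h := FreeGroup.Red.Step.not (L₁ := L) (L₂ := []) (x := d.1) (b := d.2)
      rw [List.append_nil] at h
      rw [List.append_assoc]
      exact Quot.sound h
    rw [hstep, toWord_mk_of_isReduced (hred.infix (List.prefix_append _ _).isInfix)]

theorem TendstoBoundary.mul_right {w : ℕ → FreeGroup ι} {X : InfWord ι}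
    (h : TendstoBoundary w X) (u : FreeGroup ι) : TendstoBoundary (fun n => w n * u) X := by
  rw [← FreeGroup.mk_toWord (x := u)]
  induction u.toWord generalizing w with
  | nil => simpa [← FreeGroup.one_eq_mk] using h
  | cons c L ih =>
    have hc : TendstoBoundary (fun n => w n * FreeGroup.mk [c]) X := by
      intro k
      filter_upwards [h (k + 1), h k] with n hn hn'
      refine (take_toWord_mul_mk_singleton ?_ c).trans hn'
      have hlen := congrArg List.length hn
      simp only [List.length_take, List.length_ofFn] at hlen
      omega
    have hL (n : ℕ) : w n * FreeGroup.mk (c :: L) = w n * FreeGroup.mk [c] * FreeGroup.mk L := by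
      rw [mul_assoc, FreeGroup.mul_mk, List.singleton_append]
    simpa only [hL] using ih hc

end Words

/-! ### Segments in `ℝ`-trees -/

section Segments

variable {T : Type*} [MetricSpace T]

theorem left_mem_seg_s15 (x y : T) : x ∈ seg x y := by simp [seg]

theorem right_mem_seg_s15 (x y : T) : y ∈ seg x y := by simp [seg]

theorem seg_comm_s15 (x y : T) : seg x y = seg y x := by
  ext z
  rw [seg, seg, mem_ofPred_eq, mem_ofPred_eq, dist_comm y x, dist_comm y z, dist_comm z x, add_comm]

theorem mem_seg_iff_of_isometry {T' : Type*} [MetricSpace T'] {f : T → T'} (hf : Isometry f)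
    {x y z : T} : f z ∈ seg (f x) (f y) ↔ z ∈ seg x y := by
  simp [seg, hf.dist_eq]

theorem mem_seg_of_mem_seg {a b a' b' z : T} (hz : z ∈ seg a b) (ha : a' ∈ seg a z)
    (hb : b' ∈ seg z b) : z ∈ seg a' b' := by
  simp only [seg, mem_ofPred_eq] at *
  linarith [dist_triangle a a' b, dist_triangle a' b' b, dist_triangle a' z b']

theorem mem_seg_or_of_mem_seg [IsRTree T] {a y p : T} (Q : T) (h : p ∈ seg a y) :
    p ∈ seg a Q ∨ p ∈ seg Q y := by
  simp only [seg, mem_ofPred_eq] at *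
  have h₄ := IsRTree.four_point a y p Q
  rcases le_max_iff.1 h₄ with h₁ | h₁
  · right
    linarith [dist_triangle Q p y, dist_comm p Q, dist_comm y Q]
  · left
    linarith [dist_triangle a p Q, dist_comm p Q, dist_comm y p]

theorem eq_of_mem_seg_of_dist_eq_s15 [IsRTree T] {x y p p' : T} (hp : p ∈ seg x y)
    (hp' : p' ∈ seg x y) (h : dist x p = dist x p') : p = p' := by
  simp only [seg, mem_ofPred_eq] at *
  have h₄ := IsRTree.four_point x y p p'
  rw [dist_comm y p, dist_comm y p', max_eq_left (by linarith)] at h₄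
  exact dist_le_zero.1 (by linarith)

/-- The segment between two points of an isometrically embedded `ℝ`-tree is contained in it. -/
theorem seg_subset_range [IsRTree T] {T' : Type*} [MetricSpace T'] [IsRTree T'] {f : T → T'}
    (hf : Isometry f) (x y : T) : seg (f x) (f y) ⊆ range f := by
  intro p hp
  obtain ⟨γ, h₀, h₁, hγ⟩ := IsRTree.geodesic x y
  have hd : dist (f x) p + dist p (f y) = dist x y := hp.trans (hf.dist_eq x y)
  have ht : dist (f x) p ∈ Icc 0 (dist x y) :=
    ⟨dist_nonneg, by linarith [dist_nonneg (x := p) (y := f y)]⟩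
  have hx : dist x (γ (dist (f x) p)) = dist (f x) p := by
    have h := hγ 0 (left_mem_Icc.2 dist_nonneg) _ ht
    rwa [h₀, zero_sub, abs_neg, abs_of_nonneg dist_nonneg] at h
  have hy : dist (γ (dist (f x) p)) y = dist x y - dist (f x) p := by
    have h := hγ _ ht _ (right_mem_Icc.2 dist_nonneg)
    rwa [h₁, abs_sub_comm, abs_of_nonneg (by linarith [ht.2])] at h
  refine ⟨γ (dist (f x) p), eq_of_mem_seg_of_dist_eq_s15 ?_ hp ?_⟩
  · exact (mem_seg_iff_of_isometry hf).2 (show _ + _ = _ by rw [hx, hy]; ring)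
  · rw [hf.dist_eq, hx]

/-- If a segment is covered by two closed sets, one containing its initial and the other its
terminal point, then it meets their intersection. -/
theorem exists_mem_seg_inter [IsRTree T] {x y : T} {A B : Set T} (hA : IsClosed A)
    (hB : IsClosed B) (hcov : seg x y ⊆ A ∪ B) (hx : x ∈ A) (hy : y ∈ B) :
    ∃ z ∈ seg x y, z ∈ A ∩ B := by
  obtain ⟨γ, h₀, h₁, hγ⟩ := IsRTree.geodesic x y
  have hcont : ContinuousOn γ (Icc 0 (dist x y)) :=
    (LipschitzOnWith.of_dist_le_mul (K := 1) fun s hs t ht => by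
      rw [hγ s hs t ht, NNReal.coe_one, one_mul, Real.dist_eq]).continuousOn
  have hsub : γ '' Icc 0 (dist x y) ⊆ seg x y := by
    rintro _ ⟨t, ht, rfl⟩
    have hx := hγ 0 (left_mem_Icc.2 dist_nonneg) t ht
    have hy := hγ t ht _ (right_mem_Icc.2 dist_nonneg)
    rw [h₀, zero_sub, abs_neg, abs_of_nonneg ht.1] at hx
    rw [h₁, abs_sub_comm, abs_of_nonneg (by linarith [ht.2])] at hy
    exact show _ + _ = _ by rw [hx, hy]; ring
  have hx' : x ∈ γ '' Icc 0 (dist x y) := ⟨0, left_mem_Icc.2 dist_nonneg, h₀⟩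
  have hy' : y ∈ γ '' Icc 0 (dist x y) := ⟨_, right_mem_Icc.2 dist_nonneg, h₁⟩
  obtain ⟨z, hz, hzAB⟩ := isPreconnected_closed_iff.1 (isPreconnected_Icc.image γ hcont) A B hA hB
    (hsub.trans hcov) ⟨x, hx', hx⟩ ⟨y, hy', hy⟩
  exact ⟨z, hsub hz, hzAB⟩

end Segments

namespace AssocTree

variable {K : Type} [MetricSpace K] {ι : Type} [DecidableEq ι] {S : SystemOfIsometries K ι}
  (A : AssocTree S)

theorem mk_smul_emb_letterPE (c : ι × Bool) {x : K} (hx : x ∈ (S.letterPE c).source) :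
    FreeGroup.mk [c] • A.emb (S.letterPE c x) = A.emb x := by
  rcases c with ⟨i, _ | _⟩
  · have h := A.compat i _ ((S.pe i).map_target hx)
    rw [(S.pe i).right_inv hx] at h
    rw [← h]
    rfl
  · exact eq_inv_smul_iff.1 (A.compat i x hx).symm

theorem mk_smul_emb_listPE (L : List (ι × Bool)) {x : K} (hx : x ∈ (S.listPE L).source) :
    FreeGroup.mk L • A.emb (S.listPE L x) = A.emb x := by
  induction L generalizing x with
  | nil => exact one_smul _ _
  | cons c L ih =>
    rw [← List.singleton_append, ← FreeGroup.mul_mk, mul_smul,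
      ← A.mk_smul_emb_letterPE c (x := x) hx.1]
    exact congrArg _ (ih hx.2)

theorem exists_emb_eq_inv_smul {w : FreeGroup ι} {x : K} (hx : x ∈ S.dom w) :
    ∃ y, w⁻¹ • A.emb x = A.emb y := by
  rw [SystemOfIsometries.dom, wordPE_eq_listPE] at hx
  have h := A.mk_smul_emb_listPE _ hx
  rw [FreeGroup.mk_toWord] at h
  exact ⟨_, inv_smul_eq_iff.2 h.symm⟩

/-- The part of `T_𝒦` covered by the translates `gK` for which the reduced word of `g` starts with
the letter `c`. -/
def halfTree (c : ι × Bool) : Set A.carrier :=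
  {p | ∃ (g : FreeGroup ι) (x : K), g.toWord.head? = some c ∧ p = g • A.emb x}

theorem exists_eq_prefixN_smul {X : InfWord ι} {k : ℕ} {q : K} (hq : q ∈ S.domInf (X.shift k))
    {m : ℕ} (hm : k ≤ m) : ∃ x, X.prefixN k • A.emb q = X.prefixN m • A.emb x := by
  obtain ⟨n, rfl⟩ := Nat.exists_eq_add_of_le hm
  obtain ⟨y, hy⟩ := A.exists_emb_eq_inv_smul (mem_iInter.1 hq n)
  refine ⟨y, ?_⟩
  rw [X.prefixN_add_s15, mul_smul, ← hy, smul_inv_smul]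

theorem emb_image_source_subset_halfTree (c : ι × Bool) :
    A.emb '' (S.letterPE c).source ⊆ A.halfTree c := by
  rintro _ ⟨x, hx, rfl⟩
  exact ⟨FreeGroup.mk [c], S.letterPE c x, rfl, (A.mk_smul_emb_letterPE c hx).symm⟩

theorem isSubtree_emb_image_source (c : ι × Bool) :
    IsSubtree (A.emb '' (S.letterPE c).source) := by
  rintro _ ⟨x, hx, rfl⟩ _ ⟨y, hy, rfl⟩ z hz
  obtain ⟨z, rfl⟩ := A.emb_subtree _ ⟨x, rfl⟩ _ ⟨y, rfl⟩ hz
  exact ⟨z, (S.isClosedSubtree_source_letterPE c).2.2 x hx y hy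
    ((mem_seg_iff_of_isometry A.emb_isom).1 hz), rfl⟩

variable [CompactSpace K]

theorem mem_emb_source_of_mem_halfTree {c : ι × Bool} {h : FreeGroup ι} {y : K}
    (hmem : h • A.emb y ∈ A.halfTree c) (hh : h.toWord.head? ≠ some c) :
    h • A.emb y ∈ A.emb '' (S.letterPE c).source := by
  obtain ⟨g, x, hg, hgh⟩ := hmem
  obtain ⟨L, hL⟩ := List.head?_eq_some_iff.1 hg
  have hred : FreeGroup.IsReduced (h⁻¹.toWord ++ g.toWord) := by
    refine List.isChain_append.2
      ⟨FreeGroup.isReduced_toWord, FreeGroup.isReduced_toWord, fun a ha b hb h₁ => ?_⟩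
    obtain rfl : c = b := by simpa [hg] using hb
    rw [FreeGroup.toWord_inv, FreeGroup.invRev, List.getLast?_reverse, List.head?_map] at ha
    obtain ⟨d, hd, rfl⟩ := Option.mem_map.1 ha
    by_contra h₂
    refine hh ?_
    rw [Option.mem_def.1 hd]
    exact congrArg some (Prod.ext h₁ (by simpa using h₂))
  have hdom := A.mem_dom_of_smul_emb_eq hgh
  have hword : (h⁻¹ * g).toWord = h⁻¹.toWord ++ g.toWord := by
    rw [← toWord_mk_of_isReduced hred, ← FreeGroup.mul_mk, FreeGroup.mk_toWord,
      FreeGroup.mk_toWord]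
  rw [SystemOfIsometries.dom, wordPE_eq_listPE, hword, listPE_append, hL] at hdom
  refine ⟨S.listPE h⁻¹.toWord y, hdom.2.1, ?_⟩
  have heq := A.mk_smul_emb_listPE _ hdom.1
  rw [FreeGroup.mk_toWord, inv_smul_eq_iff] at heq
  exact heq

theorem isClosed_biUnion_smul (F : Finset (FreeGroup ι)) :
    IsClosed (⋃ g ∈ F, g • range A.emb) := by
  refine F.finite_toSet.isClosed_biUnion fun g _ => IsCompact.isClosed ?_
  exact (isCompact_range A.emb_isom.continuous).image (A.act_isom g).continuous

/-- A segment leaving a half-tree crosses the subtree along which the half-tree is glued to its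
complement. -/
theorem exists_mem_seg_of_mem_halfTree {c : ι × Bool} {a z : A.carrier} (ha : a ∈ A.halfTree c)
    (hz : z ∉ A.halfTree c) : ∃ p ∈ seg a z, p ∈ A.emb '' (S.letterPE c).source := by
  have := A.tree
  obtain ⟨F, hF⟩ := A.seg_cover a z
  have hin {p : A.carrier} (hp : p ∈ ⋃ g ∈ F.filter (·.toWord.head? = some c), g • range A.emb) :
      p ∈ A.halfTree c := by
    simp only [Finset.mem_filter, mem_iUnion, exists_prop] at hp
    obtain ⟨g, ⟨-, hg⟩, _, ⟨x, rfl⟩, rfl⟩ := hp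
    exact ⟨g, x, hg, rfl⟩
  have hout {p : A.carrier} (hp : p ∈ ⋃ g ∈ F.filter (¬ ·.toWord.head? = some c), g • range A.emb)
      (hp' : p ∈ A.halfTree c) : p ∈ A.emb '' (S.letterPE c).source := by
    simp only [Finset.mem_filter, mem_iUnion, exists_prop] at hp
    obtain ⟨g, ⟨-, hg⟩, _, ⟨x, rfl⟩, rfl⟩ := hp
    exact A.mem_emb_source_of_mem_halfTree hp' hg
  have hcov : seg a z ⊆ (⋃ g ∈ F.filter (·.toWord.head? = some c), g • range A.emb) ∪
      ⋃ g ∈ F.filter (¬ ·.toWord.head? = some c), g • range A.emb := by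
    rw [← Finset.set_biUnion_union, Finset.filter_union_filter_not_eq]
    exact hF
  rcases hcov (left_mem_seg_s15 a z) with ha' | ha'
  · have hz' := (hcov (right_mem_seg_s15 a z)).resolve_left fun h => hz (hin h)
    obtain ⟨p, hp, hp₁, hp₂⟩ := exists_mem_seg_inter (A.isClosed_biUnion_smul _)
      (A.isClosed_biUnion_smul _) hcov ha' hz'
    exact ⟨p, hp, hout hp₂ (hin hp₁)⟩
  · exact ⟨a, left_mem_seg_s15 a z, hout ha' ha⟩

theorem isSubtree_halfTree (c : ι × Bool) : IsSubtree (A.halfTree c) := by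
  intro a ha b hb z hz
  by_contra hzc
  obtain ⟨a', ha', hac⟩ := A.exists_mem_seg_of_mem_halfTree ha hzc
  obtain ⟨b', hb', hbc⟩ := A.exists_mem_seg_of_mem_halfTree hb hzc
  rw [seg_comm_s15] at hb'
  exact hzc (A.emb_image_source_subset_halfTree c
    (A.isSubtree_emb_image_source c a' hac b' hbc (mem_seg_of_mem_seg hz ha' hb')))

theorem exists_mem_domInf_of_forall {X : InfWord ι} {p : A.carrier} {M : ℕ}
    (h : ∀ m ≥ M, ∃ x, p = X.prefixN m • A.emb x) :
    ∃ x ∈ S.domInf (X.shift M), p = X.prefixN M • A.emb x := by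
  obtain ⟨x, hx⟩ := h M le_rfl
  refine ⟨x, mem_iInter.2 fun n => ?_, hx⟩
  obtain ⟨y, hy⟩ := h (M + n) (by omega)
  have hdom := A.mem_dom_of_smul_emb_eq (hx.symm.trans hy)
  rwa [X.prefixN_add_s15, inv_mul_cancel_left] at hdom

/-- A point `p ≠ 𝒬_𝒦(X)` of `T_𝒦` does not separate `𝒬_𝒦(X)` from `wₙ P`, for `n` large. -/
theorem eventually_notMem_seg (hind : S.IndependentGenerators) {X : InfWord ι} {k : ℕ} {q : K}
    (hq : q ∈ S.domInf (X.shift k)) (P : A.carrier) {w : ℕ → FreeGroup ι}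
    (hw : TendstoBoundary w X) {p : A.carrier} (hp : p ≠ X.prefixN k • A.emb q) :
    ∀ᶠ n in atTop, p ∉ seg (X.prefixN k • A.emb q) (w n • P) := by
  by_contra hfreq
  rw [not_eventually] at hfreq
  simp only [not_not] at hfreq
  obtain ⟨g, y, hgy⟩ := A.orbit_meets p
  obtain ⟨u, x₀, hP⟩ := A.orbit_meets P
  have hmem : ∀ m ≥ max k g.norm, ∃ x, p = X.prefixN m • A.emb x := by
    intro m hm
    obtain ⟨n, hn, hwn⟩ := (hfreq.and_eventually (hw.mul_right u (m + 1))).exists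
    have hseg : (X.prefixN m)⁻¹ • p ∈ seg ((X.prefixN m)⁻¹ • X.prefixN k • A.emb q)
        ((X.prefixN m)⁻¹ • w n • P) :=
      (mem_seg_iff_of_isometry (A.act_isom (X.prefixN m)⁻¹)).2 hn
    have hQ : (X.prefixN m)⁻¹ • X.prefixN k • A.emb q ∈ A.halfTree (X.letter m) := by
      obtain ⟨x, hx⟩ := A.exists_eq_prefixN_smul hq (m := m + 1) (by omega)
      refine ⟨FreeGroup.mk [X.letter m], x, rfl, ?_⟩
      rw [hx, X.prefixN_succ, mul_smul, inv_smul_smul]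
    have hwP : (X.prefixN m)⁻¹ • w n • P ∈ A.halfTree (X.letter m) :=
      ⟨(X.prefixN m)⁻¹ * (w n * u), x₀, X.head?_eq_of_take_eq hwn, by simp only [hP, mul_smul]⟩
    have hpm := A.isSubtree_halfTree _ _ hQ _ hwP hseg
    rw [hgy, ← mul_smul] at hpm
    obtain ⟨x, -, hx⟩ := A.mem_emb_source_of_mem_halfTree hpm
      (X.head?_ne_of_norm_le (le_of_max_le_right hm))
    refine ⟨x, ?_⟩
    rw [hx, mul_smul, smul_inv_smul, hgy]
  obtain ⟨x, hx, hpx⟩ := A.exists_mem_domInf_of_forall hmem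
  obtain ⟨x', hx', hQx'⟩ := A.exists_mem_domInf_of_forall fun m (hm : m ≥ max k g.norm) =>
    A.exists_eq_prefixN_smul hq (le_of_max_le_left hm)
  obtain ⟨z, hz⟩ := hind (X.shift (max k g.norm)) fun n => ⟨x, mem_iInter.1 hx n⟩
  rw [hz, mem_singleton_iff] at hx hx'
  exact hp (by rw [hpx, hQx', hx, hx'])

end AssocTree

/-! ### Directions in `T̂` -/

section Hat

variable {T : Type} [MetricSpace T] [IsRTree T]

/-- A ray can be rerouted through a geodesic from a point `Q` to one of its points `r t`, provided
`r t` lies between `Q` and the remaining points of the ray. -/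
theorem exists_ray_through {Q : T} (r : Ray T) {t : ℝ} (ht : 0 ≤ t)
    (h : ∀ s, t ≤ s → r.1 t ∈ seg Q (r.1 s)) :
    ∃ r' : Ray T, Quotient.mk (rayEnd T) r' = Quotient.mk (rayEnd T) r ∧ r'.1 0 = Q ∧
      ∃ s, 0 ≤ s ∧ r'.1 s = r.1 t := by
  obtain ⟨γ, h₀, h₁, hγ⟩ := IsRTree.geodesic Q (r.1 t)
  set d := dist Q (r.1 t) with hd
  have hd₀ : 0 ≤ d := dist_nonneg
  have hQr (s : ℝ) (hs : d ≤ s) : dist Q (r.1 (t + (s - d))) = s := by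
    have h₂ := h (t + (s - d)) (by linarith)
    rw [seg, mem_ofPred_eq, r.2 _ _ ht (by linarith), ← hd,
      show t - (t + (s - d)) = -(s - d) by ring, abs_neg, abs_of_nonneg (by linarith)] at h₂
    linarith
  have hγd (s : ℝ) (hs : 0 ≤ s) (hs' : s ≤ d) : dist (γ s) (r.1 t) = d - s := by
    have h₂ := hγ s ⟨hs, hs'⟩ d ⟨hd₀, le_rfl⟩
    rwa [h₁, abs_sub_comm, abs_of_nonneg (by linarith)] at h₂
  have hγr (s s' : ℝ) (hs : 0 ≤ s) (hsd : s ≤ d) (hs' : d ≤ s') :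
      dist (γ s) (r.1 (t + (s' - d))) = s' - s := by
    have h₂ := hγ 0 ⟨le_rfl, hd₀⟩ s ⟨hs, hsd⟩
    rw [h₀, zero_sub, abs_neg, abs_of_nonneg hs] at h₂
    have h₃ := r.2 t (t + (s' - d)) ht (by linarith)
    rw [show t - (t + (s' - d)) = -(s' - d) by ring, abs_neg, abs_of_nonneg (by linarith)] at h₃
    refine le_antisymm ?_ ?_
    · linarith [dist_triangle (γ s) (r.1 t) (r.1 (t + (s' - d))), hγd s hs hsd]
    · linarith [dist_triangle Q (γ s) (r.1 (t + (s' - d))), hQr s' hs']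
  let ρ : ℝ → T := fun s => if s ≤ d then γ s else r.1 (t + (s - d))
  have hρ : IsRay ρ := by
    intro s s' hs hs'
    by_cases h₂ : s ≤ d <;> by_cases h₃ : s' ≤ d <;> simp only [ρ, h₂, h₃, if_true, if_false]
    · exact hγ s ⟨hs, h₂⟩ s' ⟨hs', h₃⟩
    · rw [hγr s s' hs h₂ (by linarith), abs_sub_comm, abs_of_nonneg (by linarith)]
    · rw [dist_comm, hγr s' s hs' h₃ (by linarith), abs_of_nonneg (by linarith)]
    · rw [r.2 _ _ (by linarith) (by linarith)]
      congr 1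
      ring
  have hρ₀ : ρ 0 = Q := by simp only [ρ, hd₀, if_true, h₀]
  have hρd : ρ d = r.1 t := by simp only [ρ, le_refl, if_true, h₁]
  refine ⟨⟨ρ, hρ⟩, Quotient.sound ⟨d + t, fun s hs => ?_⟩, hρ₀, d, hd₀, hρd⟩
  change dist (ρ s) (r.1 s) ≤ d + t
  by_cases h₂ : s ≤ d
  · simp only [ρ, h₂, if_true]
    have h₃ := dist_triangle (γ s) (r.1 t) (r.1 s)
    rw [hγd s hs h₂, r.2 t s ht hs] at h₃
    rcases abs_cases (t - s) with ⟨h₄, -⟩ | ⟨h₄, -⟩ <;> linarith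
  · simp only [ρ, h₂, if_false]
    rw [r.2 _ _ (by linarith) hs, abs_le]
    constructor <;> linarith

/-- If a point `p` separates `x ∈ T̂` from `y`, then it separates `x` from `Q` or `Q` from `y`. -/
theorem mem_segHat_or_of_mem_segHat {x : TreeHat T} {y p : T} (Q : T)
    (h : (Sum.inl p : TreeHat T) ∈ segHat x (Sum.inl y)) :
    (Sum.inl p : TreeHat T) ∈ segHat x (Sum.inl Q) ∨ p ∈ seg Q y := by
  rcases x with a | η
  · obtain ⟨p', hp', hpp'⟩ := h
    obtain rfl := Sum.inl_injective hpp'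
    exact (mem_seg_or_of_mem_seg Q hp').imp_left fun h => ⟨_, h, rfl⟩
  · rcases h with h | ⟨p', ⟨r, hr, hr₀, t, ht, hrt⟩, hpp'⟩
    · exact absurd h Sum.inl_ne_inr
    obtain rfl := Sum.inl_injective hpp'
    subst hrt
    refine or_iff_not_imp_right.2 fun hQ => ?_
    have hseg (s : ℝ) (hs : t ≤ s) : r.1 t ∈ seg Q (r.1 s) := by
      have hmem : r.1 t ∈ seg (r.1 s) y := by
        rw [← hr₀, seg, mem_ofPred_eq, r.2 _ _ (ht.trans hs) ht, r.2 _ _ ht le_rfl,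
          r.2 _ _ (ht.trans hs) le_rfl, abs_of_nonneg (by linarith), abs_of_nonneg (by linarith),
          abs_of_nonneg (by linarith)]
        ring
      rw [seg_comm_s15]
      exact (mem_seg_or_of_mem_seg Q hmem).resolve_right hQ
    obtain ⟨r', hr', hr'₀, s, hs, hr's⟩ := exists_ray_through r ht hseg
    exact Or.inr ⟨_, ⟨r', hr'.trans hr, hr'₀, s, hs, hr's⟩, rfl⟩

/-- A sequence of points of `T` converges to `Q` in the observers' topology as soon as no other
point of `T` separates infinitely many of its members from `Q`. -/
theorem tendsto_observersTopology {y : ℕ → T} {Q : T}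
    (h : ∀ p, p ≠ Q → ∀ᶠ n in atTop, p ∉ seg Q (y n)) :
    Tendsto (fun n => (Sum.inl (y n) : TreeHat T)) atTop
      (@nhds _ (observersTopology T) (Sum.inl Q)) := by
  refine TopologicalSpace.tendsto_nhds_generateFrom_iff.2 ?_
  rintro _ ⟨P, x, hxP, rfl⟩ ⟨hQP, hPQ⟩
  rcases P with p | ξ
  · have hpQ : p ≠ Q := fun h => hQP (congrArg Sum.inl h.symm)
    filter_upwards [h p hpQ] with n hn
    refine ⟨fun hyp => hn ?_, fun hmem => ?_⟩
    · rw [← Sum.inl_injective hyp]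
      exact right_mem_seg_s15 _ _
    · exact (mem_segHat_or_of_mem_segHat Q hmem).elim hPQ hn
  · refine Eventually.of_forall fun n => ⟨Sum.inl_ne_inr, fun hmem => ?_⟩
    rcases x with a | η
    · obtain ⟨_, _, hp⟩ := hmem
      exact Sum.inl_ne_inr hp
    · rcases hmem with hmem | ⟨_, _, hp⟩
      · exact hxP hmem.symm
      · exact Sum.inl_ne_inr hp

end Hat

/-- **Proposition 4.7.**  Let `𝒦 = (K, 𝒜)` have independent generators and let
`X ∈ ∂F(𝒜)` be eventually admissible, say `X_k⁻¹ X` is admissible with one-point domain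
`{q}`, so that `𝒬_𝒦(X) = X_k · q ∈ T_𝒦`.  Then for every `P ∈ T_𝒦` and every sequence
`wₙ → X` in `F(𝒜) ∪ ∂F(𝒜)`, the points `wₙ P` converge to `𝒬_𝒦(X)` in the observers'
topology on `T̂_𝒦`. -/
theorem QK_eventually_admissible (K : Type) [MetricSpace K] [CompactSpace K] [IsRTree K]
    (ι : Type) [Fintype ι] [DecidableEq ι] (S : SystemOfIsometries K ι)
    (hind : S.IndependentGenerators) (A : AssocTree S)
    (Tc : Type) [MetricSpace Tc] [CompleteSpace Tc] (hTc : IsRTree Tc)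
    (e : A.carrier → Tc) (he : Isometry e) (hdense : DenseRange e)
    (X : InfWord ι) (hX : S.EventuallyAdmissible X) :
    ∀ (k : ℕ) (q : K), S.AdmissibleInf (X.shift k) → S.domInf (X.shift k) = {q} →
      ∀ (P : A.carrier) (w : ℕ → FreeGroup ι), TendstoBoundary w X →
        Filter.Tendsto (fun n => (Sum.inl (e (w n • P)) : TreeHat Tc)) Filter.atTop
          (@nhds _ (observersTopology Tc) (Sum.inl (e (X.prefixN k • A.emb q)))) := by
  intro k q _ hq P w hw
  have := A.tree
  refine tendsto_observersTopology fun p hp => ?_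
  have hq' : q ∈ S.domInf (X.shift k) := hq ▸ mem_singleton q
  by_cases hpe : p ∈ range e
  · obtain ⟨p, rfl⟩ := hpe
    filter_upwards [A.eventually_notMem_seg hind hq' P hw fun h => hp (congrArg e h)] with n hn
    exact fun hmem => hn ((mem_seg_iff_of_isometry he).1 hmem)
  · exact Eventually.of_forall fun n hmem => hpe (seg_subset_range he _ _ hmem)

end CHL
end
end
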